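/- arXiv:2006.16237 — 3 statements merged into one kernel-verified Lean document; each statement's English description precedes it below -/
import Mathlib

section
/- Assume α, β, γ are positive irrational numbers with α + β + γ = 1, β < 1/2 and α < γ, and assume in addition that 1, α, β are linearly independent over ℚ. With b, b̃, c, c̃ as defined in the context: b(n) − b̃(n) = 1 with density α/2, b(n) − b̃(n) = −1 with density α/2, and b(n) − b̃(n) = 0 with density 1 − α; c(n) − c̃(n) = 1 with density (1/8 − αβ/2)/γ, c(n) − c̃(n) = −1 with density (1/8 − αβ/2)/γ, and c(n) − c̃(n) = 0 with density (γ − 1/4 + αβ)/γ. (Here 'f(n) = c with density κ' means lim_{N→∞} (1/N)·#{n ≤ N : f(n) = c} = κ.) -/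
open Filter

/-- The `n`-th term of the Webster sequence of density `d`: `⌈(n - 1/2)/d⌉`. -/
noncomputable def wTerm (d : ℝ) (n : ℕ) : ℕ := ⌈((n : ℝ) - 1/2) / d⌉₊

/-- `u_n = {nd + 1/2}` (fractional part), for density `d`. -/
noncomputable def fpart (d : ℝ) (n : ℕ) : ℝ := Int.fract ((n : ℝ) * d + 1/2)

/-- The set `W̃_α` of Algorithm 2. -/
def WtA (α : ℝ) : Set ℕ := {n : ℕ | 1 ≤ n ∧ fpart α n < α}

/-- The set `W̃_β` of Algorithm 2. -/
def WtB (α β : ℝ) : Set ℕ := {n : ℕ | 1 ≤ n ∧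
  ((α < fpart α n ∧ fpart β n < β) ∨
   (1 - α < fpart α n ∧ 1 - β/2 < fpart β n) ∨
   (α < fpart α n ∧ fpart α n < 2*α ∧ β < fpart β n ∧ fpart β n < 3*β/2))}

/-- The set `W̃_γ` of Algorithm 2. -/
def WtC (α β : ℝ) : Set ℕ := {n : ℕ | 1 ≤ n} \ (WtA α ∪ WtB α β)

/-- The `n`-th smallest element (1-indexed) of a set of naturals. -/
noncomputable def nthElt (S : Set ℕ) (n : ℕ) : ℕ := Nat.nth (· ∈ S) (n - 1)

/-- `f(n) = c` holds with density `κ`. -/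
def HasDensity (f : ℕ → ℤ) (c : ℤ) (κ : ℝ) : Prop :=
  Tendsto (fun N : ℕ => ({n : ℕ | 1 ≤ n ∧ n ≤ N ∧ f n = c}.ncard : ℝ) / N)
    atTop (nhds κ)

section Equidistribution

open MeasureTheory Topology UnitAddTorus

/-- The quotient map from the plane to the two-dimensional torus. -/
noncomputable def torusMk (p : ℝ × ℝ) : UnitAddTorus (Fin 2) :=
  fun i => ((![p.1, p.2] i : ℝ) : UnitAddCircle)

lemma continuous_torusMk : Continuous torusMk := by
  refine continuous_pi fun i => (AddCircle.continuous_mk' 1).comp ?_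
  fin_cases i
  · exact continuous_fst
  · exact continuous_snd

lemma isOpenMap_torusMk : IsOpenMap torusMk := by
  have h1 : IsOpenMap (Pi.map (fun _ : Fin 2 => ((↑) : ℝ → UnitAddCircle))) :=
    IsOpenMap.piMap (fun _ => QuotientAddGroup.isOpenMap_coe)
      (Eventually.of_forall fun _ => QuotientAddGroup.mk_surjective)
  exact h1.comp (Homeomorph.finTwoArrow (X := ℝ)).symm.isOpenMap

lemma mFourier_torusMk (k : Fin 2 → ℤ) (p : ℝ × ℝ) :
    mFourier k (torusMk p) =
      fourier (k 0) (p.1 : UnitAddCircle) * fourier (k 1) (p.2 : UnitAddCircle) := by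
  simp [mFourier, torusMk, Fin.prod_univ_two]

/-- The open unit square. -/
def unitSquare : Set (ℝ × ℝ) := Set.Ioo 0 1 ×ˢ Set.Ioo 0 1

lemma isOpen_unitSquare : IsOpen unitSquare := isOpen_Ioo.prod isOpen_Ioo

lemma volume_unitSquare : volume unitSquare = 1 := by
  simp [unitSquare, Measure.volume_eq_prod]

lemma integral_fourier_Ioo {k : ℤ} (hk : k ≠ 0) :
    ∫ x in Set.Ioo (0 : ℝ) 1, fourier k (x : UnitAddCircle) = 0 := by
  rw [← integral_Ioc_eq_integral_Ioo, ← intervalIntegral.integral_of_le zero_le_one]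
  simp only [fourier_coe_apply]
  have hc : (2 * Real.pi * Complex.I * k : ℂ) ≠ 0 := by
    simp [Real.pi_ne_zero, hk]
  have h := integral_exp_mul_complex (a := 0) (b := 1) hc
  have h1 : Complex.exp (2 * Real.pi * Complex.I * k) = 1 :=
    Complex.exp_eq_one_iff.2 ⟨k, by ring⟩
  simp only [Complex.ofReal_one, mul_one, h1, Complex.ofReal_zero, mul_zero, Complex.exp_zero,
    sub_self, zero_div, div_one] at h ⊢
  exact h

lemma integral_mFourier_torusMk {k : Fin 2 → ℤ} (hk : k ≠ 0) :
    ∫ p in unitSquare, mFourier k (torusMk p) = 0 := by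
  simp only [mFourier_torusMk]
  rw [unitSquare, Measure.volume_eq_prod, setIntegral_prod_mul
    (fun x : ℝ => fourier (k 0) (x : UnitAddCircle))
    (fun x : ℝ => fourier (k 1) (x : UnitAddCircle))]
  by_cases h0 : k 0 = 0
  · have h1 : k 1 ≠ 0 := fun h1 => hk (by ext i; fin_cases i <;> simp [h0, h1])
    rw [integral_fourier_Ioo h1, mul_zero]
  · rw [integral_fourier_Ioo h0, zero_mul]

lemma int_combination_not_int {a b : ℝ} (h : LinearIndependent ℚ ![(1 : ℝ), a, b])
    {k l m : ℤ} (hkl : k * a + l * b = m) : k = 0 ∧ l = 0 := by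
  rw [Fintype.linearIndependent_iff] at h
  have := h ![-m, k, l] (by
    simp only [Fin.sum_univ_three, Matrix.cons_val, Rat.smul_def]
    push_cast
    linarith)
  have h1 := this 1
  have h2 := this 2
  simp only [Matrix.cons_val] at h1 h2
  exact ⟨by exact_mod_cast h1, by exact_mod_cast h2⟩

/-- The point at time `n` of the linear flow on the plane with direction `(a, b)`, started
at `(1/2, 1/2)`. -/
noncomputable def orbitPt (a b : ℝ) (n : ℕ) : ℝ × ℝ := (n * a + 1 / 2, n * b + 1 / 2)

lemma mFourier_orbitPt (a b : ℝ) (k : Fin 2 → ℤ) (n : ℕ) :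
    mFourier k (torusMk (orbitPt a b n)) =
      Complex.exp (Real.pi * Complex.I * (k 0 + k 1)) *
        Complex.exp (2 * Real.pi * Complex.I * (k 0 * a + k 1 * b)) ^ n := by
  rw [mFourier_torusMk, fourier_coe_apply, fourier_coe_apply, ← Complex.exp_add,
    ← Complex.exp_nat_mul, ← Complex.exp_add]
  congr 1
  simp only [orbitPt]
  push_cast
  ring

lemma tendsto_average_mFourier {a b : ℝ} (h : LinearIndependent ℚ ![(1 : ℝ), a, b])
    (k : Fin 2 → ℤ) :
    Tendsto (fun N : ℕ => ((N : ℂ) + 1)⁻¹ *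
      ∑ n ∈ Finset.range (N + 1), mFourier k (torusMk (orbitPt a b n))) atTop
      (𝓝 (∫ p in unitSquare, mFourier k (torusMk p))) := by
  by_cases hk : k = 0
  · subst hk
    have h1 : ∀ N : ℕ, ((N : ℂ) + 1)⁻¹ * ((N : ℂ) + 1) = 1 := fun N =>
      inv_mul_cancel₀ (by exact_mod_cast N.succ_ne_zero)
    simp [mFourier_zero, h1, volume_unitSquare, Measure.real]
  rw [integral_mFourier_torusMk hk]
  set z := Complex.exp (2 * Real.pi * Complex.I * (k 0 * a + k 1 * b)) with hz
  have hz1 : z ≠ 1 := by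
    intro h1
    obtain ⟨m, hm⟩ := Complex.exp_eq_one_iff.1 h1
    have h2 : ((k 0 : ℂ) * a + k 1 * b) = m := by
      have : (2 * Real.pi * Complex.I : ℂ) ≠ 0 := by simp [Real.pi_ne_zero]
      apply mul_left_cancel₀ this
      rw [hm]; ring
    have h3 := int_combination_not_int h (by exact_mod_cast h2)
    exact hk (by ext i; fin_cases i <;> simp [h3])
  have hznorm : ‖z‖ = 1 := by
    rw [hz, Complex.norm_exp]
    simp
  have hbound : ∀ N : ℕ, ‖((N : ℂ) + 1)⁻¹ *
      ∑ n ∈ Finset.range (N + 1), mFourier k (torusMk (orbitPt a b n))‖ ≤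
      (2 / ‖z - 1‖) * (1 / ((N : ℝ) + 1)) := by
    intro N
    simp only [mFourier_orbitPt, ← Finset.mul_sum]
    rw [← hz, geom_sum_eq hz1, norm_mul, norm_mul, norm_div, norm_inv]
    have h1 : ‖Complex.exp (Real.pi * Complex.I * (k 0 + k 1))‖ = 1 := by
      rw [Complex.norm_exp]
      simp
    have h2 : ‖z ^ (N + 1) - 1‖ ≤ 2 := by
      refine (norm_sub_le _ _).trans ?_
      rw [norm_pow, hznorm]
      norm_num
    have h3 : ‖(N : ℂ) + 1‖ = (N : ℝ) + 1 := by
      have := Complex.norm_natCast (N + 1)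
      push_cast at this
      exact this
    rw [h1, h3, one_mul, mul_comm, one_div]
    gcongr
  refine squeeze_zero_norm hbound ?_
  simpa using tendsto_one_div_add_atTop_nhds_zero_nat.const_mul (2 / ‖z - 1‖)

/-- **Weyl's criterion** for the orbit of a totally irrational translation of the torus. -/
lemma tendsto_average_continuousMap {a b : ℝ} (h : LinearIndependent ℚ ![(1 : ℝ), a, b])
    (f : C(UnitAddTorus (Fin 2), ℂ)) :
    Tendsto (fun N : ℕ => ((N : ℂ) + 1)⁻¹ *
      ∑ n ∈ Finset.range (N + 1), f (torusMk (orbitPt a b n))) atTop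
      (𝓝 (∫ p in unitSquare, f (torusMk p))) := by
  have hint : ∀ f : C(UnitAddTorus (Fin 2), ℂ),
      IntegrableOn (fun p => f (torusMk p)) unitSquare := fun f =>
    Measure.integrableOn_of_bounded (M := ‖f‖) (by simp [volume_unitSquare])
      (f.continuous.comp continuous_torusMk).aestronglyMeasurable
      (Eventually.of_forall fun p => f.norm_coe_le_norm _)
  have hequi : Equicontinuous fun (N : ℕ) (f : C(UnitAddTorus (Fin 2), ℂ)) =>
      ((N : ℂ) + 1)⁻¹ * ∑ n ∈ Finset.range (N + 1), f (torusMk (orbitPt a b n)) := by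
    refine Metric.equicontinuous_of_continuity_modulus id tendsto_id _ fun f g N => ?_
    have h3 : ‖(N : ℂ) + 1‖ = (N : ℝ) + 1 := by
      have := Complex.norm_natCast (N + 1)
      push_cast at this
      exact this
    rw [dist_eq_norm, ← mul_sub, ← Finset.sum_sub_distrib, norm_mul, norm_inv, h3,
      inv_mul_le_iff₀ (by positivity)]
    refine (norm_sum_le_of_le _ (n := fun _ => dist f g) fun n _ => ?_).trans (by simp)
    rw [← dist_eq_norm]
    exact ContinuousMap.dist_apply_le_dist _
  have hcont : Continuous fun f : C(UnitAddTorus (Fin 2), ℂ) =>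
      ∫ p in unitSquare, f (torusMk p) := by
    refine LipschitzWith.continuous (K := 1) (LipschitzWith.of_dist_le_mul fun f g => ?_)
    rw [dist_eq_norm, ← integral_sub (hint f) (hint g)]
    refine (norm_setIntegral_le_of_norm_le_const (C := dist f g)
      (by simp [volume_unitSquare]) fun p _ => ?_).trans
      (by simp [Measure.real, volume_unitSquare])
    rw [← dist_eq_norm]
    exact ContinuousMap.dist_apply_le_dist _
  have hclosed := hequi.isClosed_setOfPred_tendsto (l := atTop) hcont
  have hmem : f ∈ (Submodule.span ℂ (Set.range (mFourier (d := Fin 2)))).topologicalClosure := by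
    rw [span_mFourier_closure_eq_top]
    trivial
  refine closure_minimal ?_ hclosed hmem
  intro g hg
  induction hg using Submodule.span_induction with
  | mem x hx =>
    obtain ⟨k, rfl⟩ := hx
    exact tendsto_average_mFourier h k
  | zero => simp
  | add x y _ _ hx hy =>
    have := Tendsto.add hx hy
    simp only [← mul_add, ← Finset.sum_add_distrib] at this
    rw [← integral_add (hint x) (hint y)] at this
    exact this
  | smul c x _ hx =>
    have := Tendsto.const_mul c hx
    rw [← integral_const_mul] at this
    refine this.congr fun N => ?_
    simp only [ContinuousMap.smul_apply, smul_eq_mul, ← Finset.mul_sum]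
    ring

/-- The uniform probability measure on the torus. -/
noncomputable def torusMeasure : ProbabilityMeasure (UnitAddTorus (Fin 2)) :=
  ⟨(volume.restrict unitSquare).map torusMk,
    have : IsProbabilityMeasure ((volume : Measure (ℝ × ℝ)).restrict unitSquare) :=
      ⟨by simp [volume_unitSquare]⟩
    Measure.isProbabilityMeasure_map continuous_torusMk.aemeasurable⟩

/-- The empirical measure of the first `N + 1` points of the orbit. -/
noncomputable def empiricalMeasure (a b : ℝ) (N : ℕ) :
    ProbabilityMeasure (UnitAddTorus (Fin 2)) :=
  ⟨((N : ENNReal) + 1)⁻¹ •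
      ∑ n ∈ Finset.range (N + 1), Measure.dirac (torusMk (orbitPt a b n)),
    ⟨by
      simp only [Measure.smul_apply, Measure.finsetSum_apply, measure_univ, Finset.sum_const,
        Finset.card_range, smul_eq_mul, nsmul_eq_mul, mul_one, Nat.cast_add, Nat.cast_one]
      exact ENNReal.inv_mul_cancel (by simp) (by finiteness)⟩⟩

lemma tendsto_empiricalMeasure {a b : ℝ} (h : LinearIndependent ℚ ![(1 : ℝ), a, b]) :
    Tendsto (empiricalMeasure a b) atTop (𝓝 torusMeasure) := by
  rw [ProbabilityMeasure.tendsto_iff_forall_integral_tendsto]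
  intro f
  have hf := tendsto_average_continuousMap h
    ⟨fun x => (f x : ℂ), Complex.continuous_ofReal.comp f.continuous⟩
  have hlim : ∫ x, f x ∂(torusMeasure : Measure (UnitAddTorus (Fin 2))) =
      ∫ p in unitSquare, f (torusMk p) :=
    integral_map continuous_torusMk.aemeasurable f.continuous.aestronglyMeasurable
  have hterm : ∀ N : ℕ, ∫ x, f x ∂(empiricalMeasure a b N : Measure (UnitAddTorus (Fin 2))) =
      ((N : ℝ) + 1)⁻¹ * ∑ n ∈ Finset.range (N + 1), f (torusMk (orbitPt a b n)) := by
    intro N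
    have h1 : (((N : ENNReal) + 1)⁻¹).toReal = ((N : ℝ) + 1)⁻¹ := by
      rw [ENNReal.toReal_inv, ENNReal.toReal_add (by finiteness) (by finiteness)]
      simp
    rw [empiricalMeasure, ProbabilityMeasure.coe_mk, integral_smul_measure, h1,
      integral_finsetSum_measure fun n _ => integrable_dirac (by simp), smul_eq_mul]
    simp
  simp only [hlim, hterm]
  simp only [ContinuousMap.coe_mk, integral_complex_ofReal] at hf
  refine ((Complex.continuous_re.tendsto _).comp hf).congr fun N => ?_
  simp only [Function.comp_apply]
  rw [← Complex.ofReal_re (((N : ℝ) + 1)⁻¹ * _)]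
  push_cast
  rfl

lemma torusMk_orbitPt (a b : ℝ) (n : ℕ) :
    torusMk (orbitPt a b n) = torusMk (fpart a n, fpart b n) := by
  funext i
  fin_cases i
  · exact (AddCircle.coe_fract (n * a + 1 / 2)).symm
  · exact (AddCircle.coe_fract (n * b + 1 / 2)).symm

lemma eq_of_torusMk_eq {p q : ℝ × ℝ} (hp : p ∈ Set.Ico (0 : ℝ) 1 ×ˢ Set.Ico (0 : ℝ) 1)
    (hq : q ∈ Set.Ico (0 : ℝ) 1 ×ˢ Set.Ico (0 : ℝ) 1) (h : torusMk p = torusMk q) : p = q := by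
  have key : ∀ {x y : ℝ}, x ∈ Set.Ico (0 : ℝ) 1 → y ∈ Set.Ico (0 : ℝ) 1 →
      (x : UnitAddCircle) = y → x = y := fun hx hy hxy =>
    (AddCircle.coe_eq_coe_iff_of_mem_Ico (p := (1 : ℝ)) (a := 0) (by simpa using hx)
      (by simpa using hy)).1 hxy
  exact Prod.ext (key hp.1 hq.1 (congrFun h 0)) (key hp.2 hq.2 (congrFun h 1))

lemma unitSquare_subset_Ico : unitSquare ⊆ Set.Ico (0 : ℝ) 1 ×ˢ Set.Ico (0 : ℝ) 1 :=
  Set.prod_mono Set.Ioo_subset_Ico_self Set.Ioo_subset_Ico_self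

lemma preimage_image_torusMk {R : Set (ℝ × ℝ)} (hR : R ⊆ unitSquare) :
    torusMk ⁻¹' (torusMk '' R) ∩ unitSquare = R := by
  ext p
  constructor
  · rintro ⟨⟨q, hq, hqp⟩, hp⟩
    rwa [← eq_of_torusMk_eq (unitSquare_subset_Ico (hR hq)) (unitSquare_subset_Ico hp) hqp]
  · exact fun hp => ⟨⟨p, hp, rfl⟩, hR hp⟩

lemma torusMeasure_frontier_image {R : Set (ℝ × ℝ)} (hc : Convex ℝ R) (hR : R ⊆ unitSquare) :
    (torusMeasure : Measure (UnitAddTorus (Fin 2))) (frontier (torusMk '' R)) = 0 := by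
  rw [torusMeasure, ProbabilityMeasure.coe_mk, Measure.map_apply continuous_torusMk.measurable
    isClosed_frontier.measurableSet, Measure.restrict_apply
    (continuous_torusMk.measurable isClosed_frontier.measurableSet),
    isOpenMap_torusMk.preimage_frontier_eq_frontier_preimage continuous_torusMk,
    ← frontier_inter_open_inter isOpen_unitSquare, preimage_image_torusMk hR]
  exact measure_mono_null Set.inter_subset_left (hc.addHaar_frontier _)

lemma torusMeasure_image {R : Set (ℝ × ℝ)} (ho : IsOpen R) (hR : R ⊆ unitSquare) :
    (torusMeasure : Measure (UnitAddTorus (Fin 2))) (torusMk '' R) = volume R := by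
  have hm : MeasurableSet (torusMk '' R) := (isOpenMap_torusMk R ho).measurableSet
  rw [torusMeasure, ProbabilityMeasure.coe_mk, Measure.map_apply continuous_torusMk.measurable hm,
    Measure.restrict_apply (continuous_torusMk.measurable hm), preimage_image_torusMk hR]

lemma fpart_mem_Ico (d : ℝ) (n : ℕ) : fpart d n ∈ Set.Ico (0 : ℝ) 1 :=
  ⟨Int.fract_nonneg _, Int.fract_lt_one _⟩

open scoped Classical in
/-- The predicate `p` holds with natural density `κ`. -/
def HasNatDensity (p : ℕ → Prop) (κ : ℝ) : Prop :=
  Tendsto (fun N : ℕ => (Nat.count p N : ℝ) / N) atTop (𝓝 κ)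

lemma hasNatDensity_fpart_mem {a b : ℝ} (h : LinearIndependent ℚ ![(1 : ℝ), a, b])
    {R : Set (ℝ × ℝ)} (ho : IsOpen R) (hc : Convex ℝ R) (hR : R ⊆ unitSquare) :
    HasNatDensity (fun n => (fpart a n, fpart b n) ∈ R) (volume.real R) := by
  classical
  rw [HasNatDensity, ← tendsto_add_atTop_iff_nat 1]
  have key := ProbabilityMeasure.tendsto_measure_of_null_frontier_of_tendsto'
    (tendsto_empiricalMeasure h) (torusMeasure_frontier_image hc hR)
  rw [torusMeasure_image ho hR] at key
  have hfin : volume R ≠ ⊤ :=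
    ((measure_mono hR).trans_lt (by simp [volume_unitSquare])).ne
  refine ((ENNReal.tendsto_toReal hfin).comp key).congr fun N => ?_
  have hm : MeasurableSet (torusMk '' R) := (isOpenMap_torusMk R ho).measurableSet
  have hmem : ∀ n : ℕ, torusMk (orbitPt a b n) ∈ torusMk '' R ↔
      (fpart a n, fpart b n) ∈ R := by
    intro n
    rw [torusMk_orbitPt]
    refine ⟨?_, fun hn => ⟨_, hn, rfl⟩⟩
    rintro ⟨q, hq, hqp⟩
    rwa [← eq_of_torusMk_eq (unitSquare_subset_Ico (hR hq))
      ⟨fpart_mem_Ico a n, fpart_mem_Ico b n⟩ hqp]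
  have hcount : (∑ n ∈ Finset.range (N + 1),
      (torusMk '' R).indicator (1 : UnitAddTorus (Fin 2) → ENNReal) (torusMk (orbitPt a b n))) =
      Nat.count (fun n => (fpart a n, fpart b n) ∈ R) (N + 1) := by
    rw [Nat.count_eq_card_filter_range, Finset.card_filter]
    push_cast
    refine Finset.sum_congr rfl fun n _ => ?_
    by_cases hn : (fpart a n, fpart b n) ∈ R
    · rw [Set.indicator_of_mem ((hmem n).2 hn), if_pos hn, Pi.one_apply]
    · rw [Set.indicator_of_notMem (mt (hmem n).1 hn), if_neg hn]
  simp only [Function.comp_apply, empiricalMeasure, ProbabilityMeasure.coe_mk,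
    Measure.smul_apply, Measure.finsetSum_apply, Measure.dirac_apply' _ hm, hcount, smul_eq_mul,
    ENNReal.toReal_mul, ENNReal.toReal_inv, ENNReal.toReal_natCast]
  rw [ENNReal.toReal_add (by finiteness) (by finiteness), div_eq_inv_mul]
  simp

end Equidistribution

section Areas

open MeasureTheory

lemma HasNatDensity.and_not {p q : ℕ → Prop} {κ κ' : ℝ} (hp : HasNatDensity p κ)
    (hq : HasNatDensity q κ') (hqp : ∀ n, q n → p n) :
    HasNatDensity (fun n => p n ∧ ¬ q n) (κ - κ') := by
  classical
  refine (Tendsto.sub hp hq).congr fun N => ?_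
  rw [← sub_div]
  congr 1
  induction N with
  | zero => simp
  | succ N ih =>
    have h := hqp N
    simp only [Nat.count_succ]
    by_cases h1 : q N
    · simp only [h1, h h1, not_true_eq_false, and_false, if_true, if_false]
      push_cast
      linarith
    · by_cases h2 : p N
      · simp only [h1, h2, not_false_eq_true, and_self, if_true, if_false]
        push_cast
        linarith
      · simp only [h1, h2, false_and, if_false]
        push_cast
        linarith

lemma HasNatDensity.congr {p q : ℕ → Prop} {κ : ℝ} (hp : HasNatDensity p κ)
    (h : ∀ n, p n ↔ q n) : HasNatDensity q κ := by
  rwa [← funext fun n => propext (h n)]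

/-- The open triangle cut from the unit square at the origin by the line `u + v = 1 / 2`. -/
def lowerTriangle : Set (ℝ × ℝ) := {p | 0 < p.1 ∧ 0 < p.2 ∧ p.1 + p.2 < 1 / 2}

/-- The open triangle cut from the unit square at `(1, 1)` by the line `u + v = 3 / 2`. -/
def upperTriangle : Set (ℝ × ℝ) := {p | p.1 < 1 ∧ p.2 < 1 ∧ 3 / 2 < p.1 + p.2}

lemma volume_real_lowerTriangle : volume.real lowerTriangle = 1 / 8 := by
  have h : lowerTriangle =
      regionBetween (fun _ => 0) (fun x : ℝ => 1 / 2 - x) (Set.Ioo 0 (1 / 2)) := by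
    ext p
    simp only [lowerTriangle, regionBetween, Set.mem_ofPred_eq, Set.mem_Ioo]
    grind
  rw [Measure.real, h, Measure.volume_eq_prod, volume_regionBetween_eq_integral
    (by simp) ((Continuous.integrableOn_Icc (by fun_prop)).mono_set Set.Ioo_subset_Icc_self)
    measurableSet_Ioo (fun x hx => by linarith [hx.2]), ← integral_Ioc_eq_integral_Ioo,
    ← intervalIntegral.integral_of_le (by norm_num)]
  simp only [Pi.sub_apply, sub_zero]
  rw [intervalIntegral.integral_sub (by simp) (by simp), integral_id]
  norm_num

lemma volume_real_upperTriangle : volume.real upperTriangle = 1 / 8 := by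
  have h : upperTriangle =
      regionBetween (fun x : ℝ => 3 / 2 - x) (fun _ => 1) (Set.Ioo (1 / 2) 1) := by
    ext p
    simp only [upperTriangle, regionBetween, Set.mem_ofPred_eq, Set.mem_Ioo]
    grind
  rw [Measure.real, h, Measure.volume_eq_prod, volume_regionBetween_eq_integral
    ((Continuous.integrableOn_Icc (by fun_prop)).mono_set Set.Ioo_subset_Icc_self) (by simp)
    measurableSet_Ioo (fun x hx => by linarith [hx.1]), ← integral_Ioc_eq_integral_Ioo,
    ← intervalIntegral.integral_of_le (by norm_num)]
  simp only [Pi.sub_apply]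
  rw [intervalIntegral.integral_sub (by simp) (Continuous.intervalIntegrable (by fun_prop) _ _),
    intervalIntegral.integral_sub (by simp) (by simp), integral_id]
  norm_num

lemma isOpen_lowerTriangle : IsOpen lowerTriangle :=
  (isOpen_lt continuous_const continuous_fst).inter
    ((isOpen_lt continuous_const continuous_snd).inter
      (isOpen_lt (continuous_fst.add continuous_snd) continuous_const))

lemma isOpen_upperTriangle : IsOpen upperTriangle :=
  (isOpen_lt continuous_fst continuous_const).inter
    ((isOpen_lt continuous_snd continuous_const).inter
      (isOpen_lt continuous_const (continuous_fst.add continuous_snd)))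

lemma convex_lowerTriangle : Convex ℝ lowerTriangle :=
  (convex_halfSpace_gt (LinearMap.fst ℝ ℝ ℝ).isLinear 0).inter
    ((convex_halfSpace_gt (LinearMap.snd ℝ ℝ ℝ).isLinear 0).inter
      (convex_halfSpace_lt (LinearMap.fst ℝ ℝ ℝ + LinearMap.snd ℝ ℝ ℝ).isLinear (1 / 2)))

lemma convex_upperTriangle : Convex ℝ upperTriangle :=
  (convex_halfSpace_lt (LinearMap.fst ℝ ℝ ℝ).isLinear 1).inter
    ((convex_halfSpace_lt (LinearMap.snd ℝ ℝ ℝ).isLinear 1).inter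
      (convex_halfSpace_gt (LinearMap.fst ℝ ℝ ℝ + LinearMap.snd ℝ ℝ ℝ).isLinear (3 / 2)))

lemma lowerTriangle_subset : lowerTriangle ⊆ unitSquare := fun p ⟨h1, h2, h3⟩ =>
  ⟨⟨h1, by linarith⟩, ⟨h2, by linarith⟩⟩

lemma upperTriangle_subset : upperTriangle ⊆ unitSquare := fun p ⟨h1, h2, h3⟩ =>
  ⟨⟨by linarith, h1⟩, ⟨by linarith, h2⟩⟩

lemma fpart_ne_zero {d : ℝ} (hd : Irrational d) (n : ℕ) : fpart d n ≠ 0 := by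
  intro h
  obtain ⟨m, hm⟩ := Int.fract_eq_zero_iff.1 h
  have h2 : ((2 * n : ℕ) : ℝ) * d = ((2 * m - 1 : ℤ) : ℝ) := by
    push_cast
    linarith
  rcases Nat.eq_zero_or_pos n with rfl | hn
  · have h3 : (2 * m - 1 : ℤ) = 0 := by
      rw [mul_zero, Nat.cast_zero, zero_mul] at h2
      exact_mod_cast h2.symm
    omega
  · exact (hd.natCast_mul (m := 2 * n) (by omega)).ne_int _ h2

lemma fpart_ne_half {d : ℝ} (hd : Irrational d) (n : ℕ) : fpart d n ≠ d / 2 := by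
  intro h
  have h1 := Int.fract_add_floor ((n : ℝ) * d + 1 / 2)
  rw [show Int.fract ((n : ℝ) * d + 1 / 2) = d / 2 from h] at h1
  refine (hd.intCast_mul (m := 2 * n - 1) (by omega)).ne_int
    (2 * ⌊(n : ℝ) * d + 1 / 2⌋ - 1) ?_
  push_cast
  linarith

lemma fpart_pos {d : ℝ} (hd : Irrational d) (n : ℕ) : 0 < fpart d n :=
  lt_of_le_of_ne (fpart_mem_Ico d n).1 (fpart_ne_zero hd n).symm

lemma fpart_lt_one (d : ℝ) (n : ℕ) : fpart d n < 1 := (fpart_mem_Ico d n).2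

variable {a b : ℝ}

lemma hasNatDensity_lower_rectangle (h : LinearIndependent ℚ ![(1 : ℝ), a, b])
    (hai : Irrational a) (hbi : Irrational b) {s t : ℝ} (hs : 0 < s) (hs1 : s < 1)
    (ht : 0 < t) (ht1 : t < 1) :
    HasNatDensity (fun n => fpart a n < s ∧ fpart b n < t) (s * t) := by
  have key := hasNatDensity_fpart_mem h (R := Set.Ioo 0 s ×ˢ Set.Ioo 0 t)
    (isOpen_Ioo.prod isOpen_Ioo) ((convex_Ioo _ _).prod (convex_Ioo _ _))
    (Set.prod_mono (Set.Ioo_subset_Ioo_right hs1.le) (Set.Ioo_subset_Ioo_right ht1.le))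
  have hv : volume.real (Set.Ioo 0 s ×ˢ Set.Ioo 0 t) = s * t := by
    simp [Measure.real, Measure.volume_eq_prod, hs.le, ht.le]
  rw [hv] at key
  exact HasNatDensity.congr key fun n => by simp [fpart_pos hai, fpart_pos hbi]

lemma hasNatDensity_upper_rectangle (h : LinearIndependent ℚ ![(1 : ℝ), a, b])
    {s t : ℝ} (hs : 0 < s) (hs1 : s < 1) (ht : 0 < t) (ht1 : t < 1) :
    HasNatDensity (fun n => 1 - s < fpart a n ∧ 1 - t < fpart b n) (s * t) := by
  have key := hasNatDensity_fpart_mem h (R := Set.Ioo (1 - s) 1 ×ˢ Set.Ioo (1 - t) 1)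
    (isOpen_Ioo.prod isOpen_Ioo) ((convex_Ioo _ _).prod (convex_Ioo _ _))
    (Set.prod_mono (Set.Ioo_subset_Ioo_left (by linarith))
      (Set.Ioo_subset_Ioo_left (by linarith)))
  have hv : volume.real (Set.Ioo (1 - s) 1 ×ˢ Set.Ioo (1 - t) 1) = s * t := by
    simp [Measure.real, Measure.volume_eq_prod, hs.le, ht.le]
  rw [hv] at key
  exact HasNatDensity.congr key fun n => by simp [fpart_lt_one]

lemma hasNatDensity_lowerTriangle (h : LinearIndependent ℚ ![(1 : ℝ), a, b])
    (hai : Irrational a) (hbi : Irrational b) :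
    HasNatDensity (fun n => fpart a n + fpart b n < 1 / 2) (1 / 8) := by
  have key := hasNatDensity_fpart_mem h isOpen_lowerTriangle convex_lowerTriangle
    lowerTriangle_subset
  rw [volume_real_lowerTriangle] at key
  exact HasNatDensity.congr key fun n => by simp [lowerTriangle, fpart_pos hai, fpart_pos hbi]

lemma hasNatDensity_upperTriangle (h : LinearIndependent ℚ ![(1 : ℝ), a, b]) :
    HasNatDensity (fun n => 3 / 2 < fpart a n + fpart b n) (1 / 8) := by
  have key := hasNatDensity_fpart_mem h isOpen_upperTriangle convex_upperTriangle
    upperTriangle_subset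
  rw [volume_real_upperTriangle] at key
  exact HasNatDensity.congr key fun n => by simp [upperTriangle, fpart_lt_one]

end Areas

section Discrepancy

open Topology

/-- The integers `m` with `x k ≤ m` are those with `k ≤ F m`, for each `k ≥ 1`: thus `F` counts
the values of `x`, which form a set of positive integers. -/
structure IsCounting (x F : ℕ → ℕ) : Prop where
  le_iff : ∀ k m, 1 ≤ k → (x k ≤ m ↔ k ≤ F m)
  zero : F 0 = 0
  mono : ∀ m, F m ≤ F (m + 1)
  succ_le : ∀ m, F (m + 1) ≤ F m + 1

namespace IsCounting

variable {x F : ℕ → ℕ}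

lemma monotone (h : IsCounting x F) : Monotone F := monotone_nat_of_le_succ h.mono

lemma pos (h : IsCounting x F) {k : ℕ} (hk : 1 ≤ k) : 1 ≤ x k := by
  by_contra hx
  have := (h.le_iff k 0 hk).1 (by omega)
  have := h.zero
  omega

lemma apply_self (h : IsCounting x F) {k : ℕ} (hk : 1 ≤ k) : F (x k) = k ∧ F (x k - 1) + 1 = k := by
  have h1 := (h.le_iff k (x k) hk).1 le_rfl
  have h2 := h.pos hk
  have h3 := (h.le_iff k (x k - 1) hk).not.1 (by omega)
  have h4 := h.succ_le (x k - 1)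
  rw [Nat.sub_add_cancel h2] at h4
  omega

lemma le_iff_le (h : IsCounting x F) {j k : ℕ} (hj : 1 ≤ j) (hk : 1 ≤ k) : x j ≤ x k ↔ j ≤ k := by
  rw [h.le_iff j _ hj, (h.apply_self hk).1]

end IsCounting

/-- Two counting functions that differ by at most one, and such that a difference never persists
through a step at which the second one is constant. -/
structure IsClose (F G : ℕ → ℕ) : Prop where
  le_left : ∀ m, F m ≤ G m + 1
  le_right : ∀ m, G m ≤ F m + 1
  not_left : ∀ m, F m = G m + 1 → F (m + 1) = G (m + 1) + 1 → G (m + 1) ≠ G m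
  not_right : ∀ m, G m = F m + 1 → G (m + 1) = F (m + 1) + 1 → G (m + 1) ≠ G m

variable {x y F G : ℕ → ℕ}

lemma IsClose.terms_le (hx : IsCounting x F) (hy : IsCounting y G) (hFG : IsClose F G) {k : ℕ}
    (hk : 1 ≤ k) : x k ≤ y k + 1 ∧ y k ≤ x k + 1 := by
  obtain ⟨h1, h2⟩ := hx.apply_self hk
  have hpos := hx.pos hk
  constructor
  · by_contra hlt
    obtain ⟨m, hm⟩ : ∃ m, x k = m + 2 := ⟨x k - 2, by omega⟩
    have h3 := (hy.le_iff k m hk).1 (by omega)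
    have h4 := hFG.le_right m
    have h5 := hFG.le_right (m + 1)
    have h6 := hx.mono m
    have h7 := hy.mono m
    rw [hm, show m + 2 - 1 = m + 1 by omega] at h2
    exact hFG.not_right m (by omega) (by omega) (by omega)
  · by_contra hlt
    have h3 := (hy.le_iff k (x k + 1) hk).not.1 (by omega)
    have h4 := hFG.le_left (x k)
    have h5 := hFG.le_left (x k + 1)
    have h6 := hx.mono (x k)
    have h7 := hy.mono (x k)
    exact hFG.not_left (x k) (by omega) (by omega) (by omega)

lemma IsClose.ncard_sub_eq_one (hx : IsCounting x F) (hy : IsCounting y G) (hFG : IsClose F G)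
    [DecidablePred fun m => G m = F m + 1] {N : ℕ} (hN : 1 ≤ N) :
    {k : ℕ | 1 ≤ k ∧ k ≤ N ∧ (x k : ℤ) - y k = 1}.ncard =
      Nat.count (fun m => G m = F m + 1) (x N) := by
  rw [Nat.count_eq_card_filter_range, ← Set.ncard_coe_finset]
  refine Set.ncard_congr (fun k _ => x k - 1) ?_ ?_ ?_
  · rintro k ⟨hk, hkN, hxy⟩
    obtain ⟨h1, h2⟩ := hx.apply_self hk
    have hpos := hx.pos hk
    have h3 := (hx.le_iff_le hk hN).2 hkN
    have h4 := (hy.le_iff k (x k - 1) hk).1 (by omega)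
    have h5 := hFG.le_right (x k - 1)
    simp only [Finset.coe_filter, Finset.mem_range, Set.mem_ofPred_eq]
    omega
  · rintro j k ⟨hj, -, -⟩ ⟨hk, -, -⟩ hjk
    have h1 := (hx.apply_self hj).2
    have h2 := (hx.apply_self hk).2
    rw [hjk] at h1
    omega
  · intro m hm
    simp only [Finset.coe_filter, Finset.mem_range, Set.mem_ofPred_eq] at hm
    obtain ⟨hmN, hm⟩ := hm
    have hk : 1 ≤ F m + 1 := by omega
    have h1 := (hx.le_iff (F m + 1) m hk).not.2 (by omega)
    have h2 := (hy.le_iff (F m + 1) m hk).2 (by omega)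
    have h3 := hFG.terms_le hx hy hk
    have h4 := (hx.le_iff_le hk hN).1 (by omega)
    exact ⟨F m + 1, ⟨hk, h4, by omega⟩, by omega⟩

lemma IsClose.ncard_sub_eq_neg_one (hx : IsCounting x F) (hy : IsCounting y G)
    (hFG : IsClose F G) [DecidablePred fun m => F m = G m + 1] {N : ℕ} (hN : 1 ≤ N) :
    {k : ℕ | 1 ≤ k ∧ k ≤ N ∧ (x k : ℤ) - y k = -1}.ncard =
      Nat.count (fun m => F m = G m + 1) (x N + 1) := by
  rw [Nat.count_eq_card_filter_range, ← Set.ncard_coe_finset]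
  refine Set.ncard_congr (fun k _ => x k) ?_ ?_ ?_
  · rintro k ⟨hk, hkN, hxy⟩
    obtain ⟨h1, h2⟩ := hx.apply_self hk
    have h3 := (hx.le_iff_le hk hN).2 hkN
    have h4 := (hy.le_iff k (x k) hk).not.1 (by omega)
    have h5 := hFG.le_left (x k)
    simp only [Finset.coe_filter, Finset.mem_range, Set.mem_ofPred_eq]
    omega
  · rintro j k ⟨hj, -, -⟩ ⟨hk, -, -⟩ hjk
    have h1 := (hx.apply_self hj).1
    have h2 := (hx.apply_self hk).1
    rw [hjk] at h1
    omega
  · intro m hm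
    simp only [Finset.coe_filter, Finset.mem_range, Set.mem_ofPred_eq] at hm
    obtain ⟨hmN, hm⟩ := hm
    have hk : 1 ≤ F m := by omega
    have h1 := (hx.le_iff (F m) m hk).2 le_rfl
    have h2 := (hy.le_iff (F m) m hk).not.2 (by omega)
    have h3 := hFG.terms_le hx hy hk
    have h4 := hx.monotone (show m ≤ x N by omega)
    rw [(hx.apply_self hN).1] at h4
    exact ⟨F m, ⟨hk, h4, by omega⟩, by omega⟩

lemma IsClose.ncard_add (hx : IsCounting x F) (hy : IsCounting y G) (hFG : IsClose F G) (N : ℕ) :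
    {k : ℕ | 1 ≤ k ∧ k ≤ N ∧ (x k : ℤ) - y k = 0}.ncard +
      ({k : ℕ | 1 ≤ k ∧ k ≤ N ∧ (x k : ℤ) - y k = 1}.ncard +
      {k : ℕ | 1 ≤ k ∧ k ≤ N ∧ (x k : ℤ) - y k = -1}.ncard) = N := by
  have hfin : ∀ c : ℤ, {k : ℕ | 1 ≤ k ∧ k ≤ N ∧ (x k : ℤ) - y k = c}.Finite := fun c =>
    (Set.finite_Icc 1 N).subset fun k hk => ⟨hk.1, hk.2.1⟩
  have hdisj : ∀ c d : ℤ, c ≠ d → Disjoint {k : ℕ | 1 ≤ k ∧ k ≤ N ∧ (x k : ℤ) - y k = c}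
      {k : ℕ | 1 ≤ k ∧ k ≤ N ∧ (x k : ℤ) - y k = d} := fun c d hcd =>
    Set.disjoint_left.2 fun k hk hk' => hcd (hk.2.2.symm.trans hk'.2.2)
  rw [← Set.ncard_union_eq (hdisj _ _ (by norm_num)) (hfin _) (hfin _),
    ← Set.ncard_union_eq (Set.disjoint_union_right.2
      ⟨hdisj _ _ (by norm_num), hdisj _ _ (by norm_num)⟩) (hfin _) ((hfin _).union (hfin _))]
  have hset : {k : ℕ | 1 ≤ k ∧ k ≤ N ∧ (x k : ℤ) - y k = 0} ∪
      ({k : ℕ | 1 ≤ k ∧ k ≤ N ∧ (x k : ℤ) - y k = 1} ∪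
        {k : ℕ | 1 ≤ k ∧ k ≤ N ∧ (x k : ℤ) - y k = -1}) = ↑(Finset.Icc 1 N) := by
    ext k
    simp only [Set.mem_union, Set.mem_ofPred_eq, Finset.coe_Icc, Set.mem_Icc]
    constructor
    · omega
    · rintro ⟨hk, hkN⟩
      have := hFG.terms_le hx hy hk
      omega
  rw [hset, Set.ncard_coe_finset, Nat.card_Icc]
  omega

lemma HasNatDensity.tendsto_count_comp {p : ℕ → Prop} [DecidablePred p] {κ l : ℝ}
    (hp : HasNatDensity p κ) {g : ℕ → ℕ} (hg : Tendsto g atTop atTop)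
    (hgl : Tendsto (fun N => (g N : ℝ) / N) atTop (𝓝 l)) :
    Tendsto (fun N => (Nat.count p (g N) : ℝ) / N) atTop (𝓝 (κ * l)) := by
  refine ((Tendsto.comp hp hg).mul hgl).congr' ?_
  filter_upwards [hg.eventually_ge_atTop 1] with N hN
  have : (g N : ℝ) ≠ 0 := by
    have : g N ≠ 0 := by omega
    exact_mod_cast this
  simp only [Function.comp_apply]
  rw [div_mul_div_cancel₀ this]
  congr!

/-- Densities of the differences of the terms of two close sequences, in terms of densities of the
differences of their counting functions. -/
theorem IsClose.hasDensity (hx : IsCounting x F) (hy : IsCounting y G) (hFG : IsClose F G)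
    {δ κ κ' : ℝ} (hxδ : Tendsto (fun N => (x N : ℝ) / N) atTop (𝓝 (1 / δ)))
    (hκ : HasNatDensity (fun m => G m = F m + 1) κ)
    (hκ' : HasNatDensity (fun m => F m = G m + 1) κ') :
    HasDensity (fun k => (x k : ℤ) - y k) 1 (κ / δ) ∧
    HasDensity (fun k => (x k : ℤ) - y k) (-1) (κ' / δ) ∧
    HasDensity (fun k => (x k : ℤ) - y k) 0 (1 - (κ / δ + κ' / δ)) := by
  have hxtop : Tendsto x atTop atTop := by
    refine tendsto_atTop_mono' atTop ?_ tendsto_id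
    filter_upwards [eventually_ge_atTop 1] with k hk
    have hle : ∀ m, F m ≤ m := fun m => by
      induction m with
      | zero => exact hx.zero.le
      | succ m ih => exact (hx.succ_le m).trans (by omega)
    have := hle (x k)
    rwa [(hx.apply_self hk).1] at this
  have hxδ' : Tendsto (fun N => ((x N + 1 : ℕ) : ℝ) / N) atTop (𝓝 (1 / δ)) := by
    have := hxδ.add tendsto_one_div_atTop_nhds_zero_nat
    rw [add_zero] at this
    refine this.congr fun N => ?_
    push_cast
    ring
  have hone : HasDensity (fun k => (x k : ℤ) - y k) 1 (κ / δ) := by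
    rw [← mul_one_div]
    refine (hκ.tendsto_count_comp hxtop hxδ).congr' ?_
    filter_upwards [eventually_ge_atTop 1] with N hN
    rw [hFG.ncard_sub_eq_one hx hy hN]
  have hneg : HasDensity (fun k => (x k : ℤ) - y k) (-1) (κ' / δ) := by
    rw [← mul_one_div]
    refine (hκ'.tendsto_count_comp (tendsto_atTop_mono (fun N => (x N).le_succ) hxtop)
      hxδ').congr' ?_
    filter_upwards [eventually_ge_atTop 1] with N hN
    rw [hFG.ncard_sub_eq_neg_one hx hy hN]
  refine ⟨hone, hneg, ((tendsto_const_nhds (x := (1 : ℝ))).sub (hone.add hneg)).congr' ?_⟩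
  filter_upwards [eventually_ge_atTop 1] with N hN
  have hN0 : (N : ℝ) ≠ 0 := by
    have : N ≠ 0 := by omega
    exact_mod_cast this
  have hadd := congrArg (Nat.cast : ℕ → ℝ) (hFG.ncard_add hx hy N)
  push_cast at hadd
  rw [← add_div, eq_div_iff hN0, sub_mul, div_mul_cancel₀ _ hN0]
  linarith

end Discrepancy

section Webster

open Topology

/-- The counting function of the Webster sequence of density `d`. -/
noncomputable def wCount (d : ℝ) (n : ℕ) : ℕ := ⌊(n : ℝ) * d + 1 / 2⌋₊

open scoped Classical in
/-- The number of elements of `S` that are at most `n`. -/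
noncomputable def setCount (S : Set ℕ) (n : ℕ) : ℕ := Nat.count (· ∈ S) (n + 1)

lemma wCount_add_fpart {d : ℝ} (hd : 0 < d) (n : ℕ) :
    wCount d n + fpart d n = n * d + 1 / 2 := by
  have h : (0 : ℝ) ≤ n * d + 1 / 2 := by positivity
  rw [wCount, fpart, natCast_floor_eq_intCast_floor h, Int.floor_add_fract]

lemma wCount_zero (d : ℝ) : wCount d 0 = 0 := by
  norm_num [wCount]

/-- Passing from `n` to `n + 1` adds `d` to `fpart d n`, with a wrap-around exactly when `n + 1` is
a term of the Webster sequence. -/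
lemma wCount_succ {d : ℝ} (hd : 0 < d) (hd1 : d < 1) (n : ℕ) :
    (d ≤ fpart d (n + 1) ∧ fpart d (n + 1) = fpart d n + d ∧ wCount d (n + 1) = wCount d n) ∨
    (fpart d (n + 1) < d ∧ fpart d (n + 1) = fpart d n + d - 1 ∧
      wCount d (n + 1) = wCount d n + 1) := by
  have h1 := wCount_add_fpart hd n
  have h2 := wCount_add_fpart hd (n + 1)
  have h3 := fpart_mem_Ico d n
  have h4 := fpart_mem_Ico d (n + 1)
  push_cast at h2
  have h5 : (wCount d (n + 1) : ℝ) < wCount d n + 2 := by linarith [h3.2, h4.1]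
  have h6 : (wCount d n : ℝ) < wCount d (n + 1) + 1 := by linarith [h3.1, h4.2]
  norm_cast at h5 h6
  rcases (show wCount d (n + 1) = wCount d n ∨ wCount d (n + 1) = wCount d n + 1 by omega)
    with h | h
  · left
    have : (wCount d (n + 1) : ℝ) = wCount d n := by exact_mod_cast h
    exact ⟨by linarith [h3.1], by linarith, h⟩
  · right
    have : (wCount d (n + 1) : ℝ) = wCount d n + 1 := by exact_mod_cast h
    exact ⟨by linarith [h3.2], by linarith, h⟩

lemma isCounting_wTerm {d : ℝ} (hd : 0 < d) (hd1 : d < 1) :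
    IsCounting (wTerm d) (wCount d) where
  le_iff k m hk := by
    rw [wTerm, wCount, Nat.ceil_le, div_le_iff₀ hd, Nat.le_floor_iff (by positivity),
      sub_le_iff_le_add]
  zero := wCount_zero d
  mono m := by rcases wCount_succ hd hd1 m with h | h <;> omega
  succ_le m := by rcases wCount_succ hd hd1 m with h | h <;> omega

lemma tendsto_wTerm_div {d : ℝ} (hd : 0 < d) :
    Tendsto (fun N : ℕ => (wTerm d N : ℝ) / N) atTop (𝓝 (1 / d)) := by
  have hinv := tendsto_one_div_atTop_nhds_zero_nat (𝕜 := ℝ)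
  have hl : Tendsto (fun N : ℕ => 1 / d - (1 / 2 / d) * (1 / (N : ℝ))) atTop (𝓝 (1 / d)) := by
    simpa using (hinv.const_mul (1 / 2 / d)).const_sub (1 / d)
  have hu : Tendsto (fun N : ℕ => 1 / d - (1 / 2 / d - 1) * (1 / (N : ℝ))) atTop
      (𝓝 (1 / d)) := by
    simpa using (hinv.const_mul (1 / 2 / d - 1)).const_sub (1 / d)
  refine tendsto_of_tendsto_of_tendsto_of_le_of_le' hl hu ?_ ?_
  all_goals
    filter_upwards [eventually_ge_atTop 1] with N hN
    have hN' : (1 : ℝ) ≤ N := by exact_mod_cast hN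
    have hN0 : (0 : ℝ) < N := by linarith
  · rw [le_div_iff₀ hN0]
    refine le_trans (le_of_eq ?_) (Nat.le_ceil _)
    field_simp
  · rw [div_le_iff₀ hN0]
    refine (Nat.ceil_lt_add_one (div_nonneg (by linarith) hd.le)).le.trans (le_of_eq ?_)
    field_simp
    ring

lemma setCount_succ_of_mem {S : Set ℕ} {n : ℕ} (h : n + 1 ∈ S) :
    setCount S (n + 1) = setCount S n + 1 := by
  classical
  rw [setCount, Nat.count_succ, if_pos h, setCount]

lemma setCount_succ_of_notMem {S : Set ℕ} {n : ℕ} (h : n + 1 ∉ S) :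
    setCount S (n + 1) = setCount S n := by
  classical
  rw [setCount, Nat.count_succ, if_neg h, setCount, add_zero]

lemma setCount_zero {S : Set ℕ} (h : 0 ∉ S) : setCount S 0 = 0 := by
  classical
  simp [setCount, Nat.count_succ, h]

lemma isCounting_nthElt {S : Set ℕ} (h0 : 0 ∉ S) (hS : S.Infinite) :
    IsCounting (nthElt S) (setCount S) where
  le_iff k m hk := by
    classical
    rw [nthElt, setCount, ← Nat.lt_succ_iff, ← not_le, Nat.succ_eq_add_one,
      ← Nat.count_le_iff_le_nth (p := (· ∈ S)) hS]
    have : Nat.count (fun x => x ∈ S) (m + 1) = setCount S m := rfl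
    omega
  zero := setCount_zero h0
  mono m := by
    by_cases h : m + 1 ∈ S
    · rw [setCount_succ_of_mem h]; omega
    · rw [setCount_succ_of_notMem h]
  succ_le m := by
    by_cases h : m + 1 ∈ S
    · rw [setCount_succ_of_mem h]
    · rw [setCount_succ_of_notMem h]; omega

lemma infinite_of_isClose {d : ℝ} (hd : 0 < d) {S : Set ℕ} (h : IsClose (wCount d) (setCount S)) :
    S.Infinite := by
  classical
  intro hfin
  have hbound : ∀ n, setCount S n ≤ S.ncard := fun n => by
    rw [setCount, Nat.count_eq_card_filter_range, ← Set.ncard_coe_finset]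
    exact Set.ncard_le_ncard (fun k hk => by simpa using (Finset.mem_filter.1 hk).2) hfin
  obtain ⟨n, hn⟩ := exists_nat_gt ((S.ncard + 2 : ℝ) / d)
  rw [div_lt_iff₀ hd] at hn
  have h1 := wCount_add_fpart hd n
  have h2 := fpart_lt_one d n
  have h3 : (S.ncard : ℝ) + 1 < wCount d n := by linarith
  norm_cast at h3
  have := hbound n
  have := h.le_left n
  omega

/-- Error densities for a set whose counting function is close to that of a Webster sequence. -/
lemma hasDensity_wTerm_sub_nthElt {d : ℝ} (hd : 0 < d) (hd1 : d < 1) {S : Set ℕ} (h0 : 0 ∉ S)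
    (h : IsClose (wCount d) (setCount S)) {κ κ' : ℝ}
    (hκ : HasNatDensity (fun m => setCount S m = wCount d m + 1) κ)
    (hκ' : HasNatDensity (fun m => wCount d m = setCount S m + 1) κ') :
    HasDensity (fun k => (wTerm d k : ℤ) - nthElt S k) 1 (κ / d) ∧
    HasDensity (fun k => (wTerm d k : ℤ) - nthElt S k) (-1) (κ' / d) ∧
    HasDensity (fun k => (wTerm d k : ℤ) - nthElt S k) 0 (1 - (κ / d + κ' / d)) :=
  h.hasDensity (isCounting_wTerm hd hd1) (isCounting_nthElt h0 (infinite_of_isClose hd h))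
    (tendsto_wTerm_div hd) hκ hκ'

end Webster

section Approximation

/-- The rectangle at the corner `(1, 1)` where `W̃_β` is ahead of the Webster sequence. -/
def Ahead (α β : ℝ) (n : ℕ) : Prop := 1 - α < fpart α n ∧ 1 - β / 2 < fpart β n

/-- The rectangle at the origin where `W̃_β` is behind the Webster sequence. -/
def Behind (α β : ℝ) (n : ℕ) : Prop := fpart α n < α ∧ fpart β n < β / 2

variable {α β γ : ℝ}

lemma Ahead.lt_add {n : ℕ} (hαβ : 2 * α + β < 1) (h : Ahead α β n) :
    3 / 2 < fpart α n + fpart β n := by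
  linarith [h.1, h.2]

lemma Behind.add_lt {n : ℕ} (hαβ : 2 * α + β < 1) (h : Behind α β n) :
    fpart α n + fpart β n < 1 / 2 := by
  linarith [h.1, h.2]

lemma fpart_zero (d : ℝ) : fpart d 0 = 1 / 2 := by
  norm_num [fpart, Int.fract_eq_iff]

lemma fpart_succ_ne {d : ℝ} (hd : 0 < d) (hd1 : d < 1) (hdi : Irrational d) (n : ℕ) :
    fpart d (n + 1) ≠ d := by
  intro h
  rcases wCount_succ hd hd1 n with h' | h'
  · exact fpart_ne_zero hdi n (by linarith)
  · linarith

lemma succ_mem_WtA {n : ℕ} : n + 1 ∈ WtA α ↔ fpart α (n + 1) < α := by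
  simp [WtA]

lemma succ_mem_WtB {n : ℕ} : n + 1 ∈ WtB α β ↔
    (α < fpart α (n + 1) ∧ fpart β (n + 1) < β) ∨
    Ahead α β (n + 1) ∨
    (α < fpart α (n + 1) ∧ fpart α (n + 1) < 2 * α ∧
      β < fpart β (n + 1) ∧ fpart β (n + 1) < 3 * β / 2) := by
  simp [WtB, Ahead]

/-- The discrepancy between `W̃_β` and the Webster sequence of density `β`. -/
lemma setCount_WtB (hα : 0 < α) (hβ : 0 < β) (hαi : Irrational α) (hβi : Irrational β)
    (hαβ : 2 * α + β < 1) (hβ2 : β < 1 / 2) (n : ℕ) :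
    (Ahead α β n ∧ setCount (WtB α β) n = wCount β n + 1) ∨
    (Behind α β n ∧ wCount β n = setCount (WtB α β) n + 1) ∨
    (¬ Ahead α β n ∧ ¬ Behind α β n ∧ setCount (WtB α β) n = wCount β n) := by
  induction n with
  | zero =>
    refine Or.inr (Or.inr ⟨?_, ?_, ?_⟩)
    · rintro ⟨h, -⟩
      rw [fpart_zero] at h
      linarith
    · rintro ⟨h, -⟩
      rw [fpart_zero] at h
      linarith
    · rw [wCount_zero, setCount_zero (by simp [WtB])]
  | succ n ih =>
    have hu := fpart_pos hαi n
    have hv := fpart_pos hβi n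
    have hu1 := fpart_lt_one α n
    have hv1 := fpart_lt_one β n
    have hu' := fpart_pos hαi (n + 1)
    have hv' := fpart_pos hβi (n + 1)
    have hu1' := fpart_lt_one α (n + 1)
    have hv1' := fpart_lt_one β (n + 1)
    have hune := fpart_succ_ne hα (by linarith) hαi n
    have hvne := fpart_succ_ne hβ (by linarith) hβi n
    have hvhalf := fpart_ne_half hβi n
    have hvhalf' := fpart_ne_half hβi (n + 1)
    have hα' := wCount_succ hα (by linarith) n
    have hβ' := wCount_succ hβ (by linarith) n
    have hS : (n + 1 ∈ WtB α β ∧ setCount (WtB α β) (n + 1) = setCount (WtB α β) n + 1) ∨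
        (n + 1 ∉ WtB α β ∧ setCount (WtB α β) (n + 1) = setCount (WtB α β) n) := by
      by_cases h : n + 1 ∈ WtB α β
      · exact Or.inl ⟨h, setCount_succ_of_mem h⟩
      · exact Or.inr ⟨h, setCount_succ_of_notMem h⟩
    rw [succ_mem_WtB] at hS
    simp only [Ahead, Behind] at *
    generalize fpart α (n + 1) = u' at *
    generalize fpart β (n + 1) = v' at *
    generalize fpart α n = u at *
    generalize fpart β n = v at *
    generalize setCount (WtB α β) n = s at *
    generalize setCount (WtB α β) (n + 1) = s' at *
    generalize wCount β n = w at *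
    generalize wCount β (n + 1) = w' at *
    rcases hα' with ⟨a1, rfl, -⟩ | ⟨a1, rfl, -⟩ <;>
      rcases hβ' with ⟨b1, rfl, rfl⟩ | ⟨b1, rfl, rfl⟩ <;>
      grind

lemma isClose_WtB (hα : 0 < α) (hβ : 0 < β) (hαi : Irrational α) (hβi : Irrational β)
    (hαβ : 2 * α + β < 1) (hβ2 : β < 1 / 2) : IsClose (wCount β) (setCount (WtB α β)) where
  le_left n := by
    rcases setCount_WtB hα hβ hαi hβi hαβ hβ2 n with h | h | h <;> omega
  le_right n := by
    rcases setCount_WtB hα hβ hαi hβi hαβ hβ2 n with h | h | h <;> omega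
  not_left n h h' := by
    have hn : Behind α β n := by
      rcases setCount_WtB hα hβ hαi hβi hαβ hβ2 n with k | k | k <;> grind
    have hn' : Behind α β (n + 1) := by
      rcases setCount_WtB hα hβ hαi hβi hαβ hβ2 (n + 1) with k | k | k <;> grind
    have := fpart_pos hβi n
    have := hn.2
    have := hn'.2
    rcases wCount_succ hβ (by linarith) n with k | k <;> linarith
  not_right n h h' := by
    have hn : Ahead α β n := by
      rcases setCount_WtB hα hβ hαi hβi hαβ hβ2 n with k | k | k <;> grind
    have hn' : Ahead α β (n + 1) := by
      rcases setCount_WtB hα hβ hαi hβi hαβ hβ2 (n + 1) with k | k | k <;> grind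
    have := fpart_lt_one β (n + 1)
    have := hn.2
    have := hn'.2
    rcases wCount_succ hβ (by linarith) n with k | k <;> linarith

lemma not_succ_mem_WtA_and_WtB (hαβ : 2 * α + β < 1) (hβ : 0 < β) (n : ℕ) :
    ¬ (n + 1 ∈ WtA α ∧ n + 1 ∈ WtB α β) := by
  rw [succ_mem_WtA, succ_mem_WtB, Ahead]
  grind

lemma succ_mem_WtC {n : ℕ} : n + 1 ∈ WtC α β ↔ n + 1 ∉ WtA α ∧ n + 1 ∉ WtB α β := by
  simp [WtC]

lemma setCount_WtC_add (hα : 0 < α) (hβ : 0 < β) (hαβ : 2 * α + β < 1) (n : ℕ) :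
    setCount (WtC α β) n + wCount α n + setCount (WtB α β) n = n := by
  induction n with
  | zero => simp [wCount_zero, setCount_zero, WtB, WtC]
  | succ n ih =>
    have hdisj := not_succ_mem_WtA_and_WtB hαβ hβ n
    have hA : (n + 1 ∈ WtA α ∧ wCount α (n + 1) = wCount α n + 1) ∨
        (n + 1 ∉ WtA α ∧ wCount α (n + 1) = wCount α n) := by
      rw [succ_mem_WtA]
      rcases wCount_succ hα (by linarith) n with h | h
      · exact Or.inr ⟨h.1.not_gt, h.2.2⟩
      · exact Or.inl ⟨h.1, h.2.2⟩
    by_cases hB : n + 1 ∈ WtB α β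
    · rw [setCount_succ_of_mem hB, setCount_succ_of_notMem fun h => (succ_mem_WtC.1 h).2 hB]
      grind
    · rw [setCount_succ_of_notMem hB]
      by_cases hA' : n + 1 ∈ WtA α
      · rw [setCount_succ_of_notMem fun h => (succ_mem_WtC.1 h).1 hA']
        grind
      · rw [setCount_succ_of_mem (succ_mem_WtC.2 ⟨hA', hB⟩)]
        grind

/-- The discrepancy between `n` and the sum of the three Webster counting functions. -/
lemma wCount_sum (hα : 0 < α) (hβ : 0 < β) (hγ : 0 < γ) (hαi : Irrational α) (hβi : Irrational β)
    (hγi : Irrational γ) (hsum : α + β + γ = 1) (n : ℕ) :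
    (fpart α n + fpart β n < 1 / 2 ∧ wCount α n + wCount β n + wCount γ n = n + 1) ∨
    (3 / 2 < fpart α n + fpart β n ∧ wCount α n + wCount β n + wCount γ n + 1 = n) ∨
    (1 / 2 ≤ fpart α n + fpart β n ∧ fpart α n + fpart β n ≤ 3 / 2 ∧
      wCount α n + wCount β n + wCount γ n = n) := by
  have h1 := wCount_add_fpart hα n
  have h2 := wCount_add_fpart hβ n
  have h3 := wCount_add_fpart hγ n
  have hu := fpart_pos hαi n
  have hv := fpart_pos hβi n
  have hw := fpart_pos hγi n
  have hu1 := fpart_lt_one α n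
  have hv1 := fpart_lt_one β n
  have hw1 := fpart_lt_one γ n
  have hs : (n : ℝ) * α + n * β + n * γ = n := by rw [← mul_add, ← mul_add, hsum, mul_one]
  have hlt : ((wCount α n + wCount β n + wCount γ n : ℕ) : ℝ) < (n + 2 : ℕ) := by
    push_cast
    linarith
  have hgt : (n : ℝ) < (wCount α n + wCount β n + wCount γ n + 2 : ℕ) := by
    push_cast
    linarith
  rw [Nat.cast_lt] at hlt hgt
  rcases (show wCount α n + wCount β n + wCount γ n = n + 1 ∨
      wCount α n + wCount β n + wCount γ n + 1 = n ∨
      wCount α n + wCount β n + wCount γ n = n by omega) with h | h | h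
  all_goals
    have hc := congrArg (Nat.cast (R := ℝ)) h
    push_cast at hc
  · exact Or.inl ⟨by linarith, h⟩
  · exact Or.inr (Or.inl ⟨by linarith, h⟩)
  · exact Or.inr (Or.inr ⟨by linarith, by linarith, h⟩)

/-- The discrepancy between `W̃_γ` and the Webster sequence of density `γ`. -/
lemma setCount_WtC (hα : 0 < α) (hβ : 0 < β) (hγ : 0 < γ) (hαi : Irrational α)
    (hβi : Irrational β) (hγi : Irrational γ) (hsum : α + β + γ = 1) (hβ2 : β < 1 / 2)
    (hαγ : α < γ) (n : ℕ) :
    ((3 / 2 < fpart α n + fpart β n ∧ ¬ Ahead α β n) ∧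
      setCount (WtC α β) n = wCount γ n + 1) ∨
    ((fpart α n + fpart β n < 1 / 2 ∧ ¬ Behind α β n) ∧
      wCount γ n = setCount (WtC α β) n + 1) ∨
    (¬ (3 / 2 < fpart α n + fpart β n ∧ ¬ Ahead α β n) ∧
      ¬ (fpart α n + fpart β n < 1 / 2 ∧ ¬ Behind α β n) ∧
      setCount (WtC α β) n = wCount γ n) := by
  have hαβ : 2 * α + β < 1 := by linarith
  have h1 := setCount_WtB hα hβ hαi hβi hαβ hβ2 n
  have h2 := setCount_WtC_add hα hβ hαβ n
  have h3 := wCount_sum hα hβ hγ hαi hβi hγi hsum n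
  have h4 := @Ahead.lt_add α β n hαβ
  have h5 := @Behind.add_lt α β n hαβ
  rcases h1 with ⟨h, hs⟩ | ⟨h, hs⟩ | ⟨h, h', hs⟩
  · have := h4 h
    have : ¬ fpart α n + fpart β n < 1 / 2 := by linarith
    have : ¬ fpart α n + fpart β n ≤ 3 / 2 := by linarith
    grind
  · have := h5 h
    have : ¬ 3 / 2 < fpart α n + fpart β n := by linarith
    have : ¬ 1 / 2 ≤ fpart α n + fpart β n := by linarith
    grind
  · rcases h3 with h3 | h3 | h3 <;> grind

lemma isClose_WtC (hα : 0 < α) (hβ : 0 < β) (hγ : 0 < γ) (hαi : Irrational α)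
    (hβi : Irrational β) (hγi : Irrational γ) (hsum : α + β + γ = 1) (hβ2 : β < 1 / 2)
    (hαγ : α < γ) : IsClose (wCount γ) (setCount (WtC α β)) where
  le_left n := by
    rcases setCount_WtC hα hβ hγ hαi hβi hγi hsum hβ2 hαγ n with h | h | h <;> omega
  le_right n := by
    rcases setCount_WtC hα hβ hγ hαi hβi hγi hsum hβ2 hαγ n with h | h | h <;> omega
  not_left n h h' heq := by
    have hmem : n + 1 ∉ WtC α β := fun hm => by
      rw [setCount_succ_of_mem hm] at heq
      omega
    have hn : fpart α n + fpart β n < 1 / 2 ∧ ¬ Behind α β n := by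
      rcases setCount_WtC hα hβ hγ hαi hβi hγi hsum hβ2 hαγ n with k | k | k
      exacts [by omega, k.1, by omega]
    have hn' : fpart α (n + 1) + fpart β (n + 1) < 1 / 2 ∧ ¬ Behind α β (n + 1) := by
      rcases setCount_WtC hα hβ hγ hαi hβi hγi hsum hβ2 hαγ (n + 1) with k | k | k
      exacts [by omega, k.1, by omega]
    have hu := fpart_pos hαi n
    have hv := fpart_pos hβi n
    have hu' := fpart_pos hαi (n + 1)
    have hv' := fpart_pos hβi (n + 1)
    have hα' := wCount_succ hα (by linarith) n
    have hβ' := wCount_succ hβ (by linarith) n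
    rw [succ_mem_WtC, succ_mem_WtA, succ_mem_WtB] at hmem
    simp only [Ahead, Behind] at *
    grind
  not_right n h h' heq := by
    have hmem : n + 1 ∉ WtC α β := fun hm => by
      rw [setCount_succ_of_mem hm] at heq
      omega
    have hn : 3 / 2 < fpart α n + fpart β n ∧ ¬ Ahead α β n := by
      rcases setCount_WtC hα hβ hγ hαi hβi hγi hsum hβ2 hαγ n with k | k | k
      exacts [k.1, by omega, by omega]
    have hn' : 3 / 2 < fpart α (n + 1) + fpart β (n + 1) ∧ ¬ Ahead α β (n + 1) := by
      rcases setCount_WtC hα hβ hγ hαi hβi hγi hsum hβ2 hαγ (n + 1) with k | k | k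
      exacts [k.1, by omega, by omega]
    have hu := fpart_lt_one α n
    have hv := fpart_lt_one β n
    have hu' := fpart_lt_one α (n + 1)
    have hv' := fpart_lt_one β (n + 1)
    have hα' := wCount_succ hα (by linarith) n
    have hβ' := wCount_succ hβ (by linarith) n
    rw [succ_mem_WtC, succ_mem_WtA, succ_mem_WtB] at hmem
    simp only [Ahead] at *
    grind

lemma iff_of_trichotomy {p q : Prop} {s w : ℕ}
    (h : (p ∧ s = w + 1) ∨ (q ∧ w = s + 1) ∨ (¬ p ∧ ¬ q ∧ s = w)) (hpq : ¬ (p ∧ q)) :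
    (p ↔ s = w + 1) ∧ (q ↔ w = s + 1) := by
  rcases h with ⟨h1, h2⟩ | ⟨h1, h2⟩ | ⟨h1, h2, h3⟩
  · exact ⟨by simp [h1, h2], by simp [show ¬ q from fun h => hpq ⟨h1, h⟩]; omega⟩
  · exact ⟨by simp [show ¬ p from fun h => hpq ⟨h, h1⟩]; omega, by simp [h1, h2]⟩
  · exact ⟨by simp [h1, h3], by simp [h2, h3]⟩

end Approximation

/-- Densities of the perturbation errors `b(n) − b̃(n)` and `c(n) − c̃(n)`. -/
theorem error_densities_perturbation (α β γ : ℝ)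
    (hα : 0 < α) (hβ : 0 < β) (hγ : 0 < γ)
    (hαi : Irrational α) (hβi : Irrational β) (hγi : Irrational γ)
    (hsum : α + β + γ = 1) (hβhalf : β < 1/2) (hαγ : α < γ)
    (hindep : LinearIndependent ℚ ![(1 : ℝ), α, β]) :
    HasDensity (fun n => (wTerm β n : ℤ) - (nthElt (WtB α β) n : ℤ)) 1 (α / 2) ∧
    HasDensity (fun n => (wTerm β n : ℤ) - (nthElt (WtB α β) n : ℤ)) (-1) (α / 2) ∧
    HasDensity (fun n => (wTerm β n : ℤ) - (nthElt (WtB α β) n : ℤ)) 0 (1 - α) ∧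
    HasDensity (fun n => (wTerm γ n : ℤ) - (nthElt (WtC α β) n : ℤ)) 1
      ((1/8 - α * β / 2) / γ) ∧
    HasDensity (fun n => (wTerm γ n : ℤ) - (nthElt (WtC α β) n : ℤ)) (-1)
      ((1/8 - α * β / 2) / γ) ∧
    HasDensity (fun n => (wTerm γ n : ℤ) - (nthElt (WtC α β) n : ℤ)) 0
      ((γ - 1/4 + α * β) / γ) := by
  have hαβ : 2 * α + β < 1 := by linarith
  have hAhead : HasNatDensity (Ahead α β) (α * (β / 2)) :=
    hasNatDensity_upper_rectangle hindep hα (by linarith) (by linarith) (by linarith)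
  have hBehind : HasNatDensity (Behind α β) (α * (β / 2)) :=
    hasNatDensity_lower_rectangle hindep hαi hβi hα (by linarith) (by linarith) (by linarith)
  have hUpper : HasNatDensity (fun n => 3 / 2 < fpart α n + fpart β n ∧ ¬ Ahead α β n)
      (1 / 8 - α * (β / 2)) :=
    (hasNatDensity_upperTriangle hindep).and_not hAhead fun n h => h.lt_add hαβ
  have hLower : HasNatDensity (fun n => fpart α n + fpart β n < 1 / 2 ∧ ¬ Behind α β n)
      (1 / 8 - α * (β / 2)) :=
    (hasNatDensity_lowerTriangle hindep hαi hβi).and_not hBehind fun n h => h.add_lt hαβ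
  have hB (n : ℕ) := iff_of_trichotomy (setCount_WtB hα hβ hαi hβi hαβ hβhalf n) fun h => by
    linarith [h.1.lt_add hαβ, h.2.add_lt hαβ]
  have hC (n : ℕ) :=
    iff_of_trichotomy (setCount_WtC hα hβ hγ hαi hβi hγi hsum hβhalf hαγ n) fun h => by
      linarith [h.1.1, h.2.1]
  obtain ⟨b₁, b₂, b₃⟩ := hasDensity_wTerm_sub_nthElt hβ (by linarith) (by simp [WtB])
    (isClose_WtB hα hβ hαi hβi hαβ hβhalf)
    (HasNatDensity.congr hAhead fun n => (hB n).1) (HasNatDensity.congr hBehind fun n => (hB n).2)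
  obtain ⟨c₁, c₂, c₃⟩ := hasDensity_wTerm_sub_nthElt hγ (by linarith) (by simp [WtC])
    (isClose_WtC hα hβ hγ hαi hβi hγi hsum hβhalf hαγ)
    (HasNatDensity.congr hUpper fun n => (hC n).1) (HasNatDensity.congr hLower fun n => (hC n).2)
  have e₁ : α * (β / 2) / β = α / 2 := by field_simp
  have e₂ : 1 / 8 - α * (β / 2) = 1 / 8 - α * β / 2 := by ring
  have e₃ : 1 - ((1 / 8 - α * β / 2) / γ + (1 / 8 - α * β / 2) / γ) =
      (γ - 1 / 4 + α * β) / γ := by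
    field_simp
    ring
  rw [e₁] at b₁ b₂ b₃
  rw [add_halves] at b₃
  rw [e₂] at c₁ c₂ c₃
  rw [e₃] at c₃
  exact ⟨b₁, b₂, b₃, c₁, c₂, c₃⟩
end

section
/- Let α, β ∈ (0,1) be such that 1, α, β are linearly independent over ℚ. Then the Webster sequences W_α and W_β are not disjoint: W_α ∩ W_β ≠ ∅. Consequently, there does not exist a partition of ℕ into pairwise disjoint sets that includes both W_α and W_β as parts. -/
/-- The Webster sequence of density `d`, as a set of positive integers. -/
def wSet (d : ℝ) : Set ℕ := {m : ℕ | ∃ n : ℕ, 1 ≤ n ∧ m = wTerm d n}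

open UnitAddTorus in
/-- A continuous function on the torus that is invariant under translation by a point at which no
nontrivial character equals `1` is constant. -/
theorem UnitAddTorus.eq_mFourierCoeff_zero_of_translation_invariant {d : Type*} [Fintype d]
    {y : UnitAddTorus d} (hy : ∀ n : d → ℤ, n ≠ 0 → mFourier n y ≠ 1)
    (f : C(UnitAddTorus d, ℂ)) (hf : ∀ t, f (t + y) = f t) (t : UnitAddTorus d) :
    f t = mFourierCoeff f 0 := by
  have hmul (n : d → ℤ) (t : UnitAddTorus d) :
      mFourier n (t + y) = mFourier n t * mFourier n y := by
    simp [mFourier, Finset.prod_mul_distrib, AddCircle.toCircle_add]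
  have hcoeff (n : d → ℤ) (hn : n ≠ 0) : mFourierCoeff f n = 0 := by
    set μ := MeasureTheory.Measure.pi fun _ : d => (AddCircle.haarAddCircle (T := 1))
    have hdef : mFourierCoeff f n = ∫ t, mFourier (-n) t • f t ∂μ := rfl
    have key : mFourierCoeff f n = mFourier (-n) y * mFourierCoeff f n := by
      rw [hdef, ← MeasureTheory.integral_const_mul]
      refine (MeasureTheory.integral_add_right_eq_self
        (fun t => mFourier (-n) t • f t) y).symm.trans ?_
      congr 1
      ext t
      rw [hmul, hf, smul_eq_mul, smul_eq_mul]
      ring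
    by_contra h
    exact hy (-n) (neg_ne_zero.mpr hn) (mul_right_cancel₀ h (by rw [← key, one_mul]))
  have hsum : HasSum (fun n => mFourierCoeff f n • mFourier n t)
      (mFourierCoeff f 0 • mFourier 0 t) :=
    hasSum_single 0 fun n hn => by rw [hcoeff n hn, zero_smul]
  have hs : Summable (mFourierCoeff f) :=
    (hasSum_single 0 fun n hn => hcoeff n hn).summable
  have := (hasSum_mFourier_series_apply_of_summable hs t).unique hsum
  simpa [mFourier_zero] using this

open UnitAddTorus in
/-- **Kronecker's density theorem** on the torus, in terms of characters. -/
theorem UnitAddTorus.denseRange_zsmul_of_mFourier_ne_one {d : Type*} [Fintype d]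
    {y : UnitAddTorus d} (hy : ∀ n : d → ℤ, n ≠ 0 → mFourier n y ≠ 1) :
    DenseRange (fun k : ℤ => k • y) := by
  set S : Set (UnitAddTorus d) := Set.range fun k : ℤ => k • y
  have hS : S.Nonempty := Set.range_nonempty _
  have hinv (t : UnitAddTorus d) : Metric.infDist (t + y) S = Metric.infDist t S := by
    have himage : (· + y) '' S = S := by
      ext z
      constructor
      · rintro ⟨_, ⟨k, rfl⟩, rfl⟩
        exact ⟨k + 1, by simp [add_zsmul]⟩
      · rintro ⟨k, rfl⟩
        exact ⟨(k - 1) • y, ⟨k - 1, rfl⟩, by simp [sub_zsmul]⟩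
    conv_lhs => rw [← himage]
    exact Metric.infDist_image (isometry_add_right y)
  have hconst := eq_mFourierCoeff_zero_of_translation_invariant hy
    ⟨fun t => (Metric.infDist t S : ℂ), by fun_prop⟩ (fun t => by simp [hinv])
  intro t
  rw [Metric.mem_closure_iff_infDist_zero hS]
  have hzero : Metric.infDist (0 : UnitAddTorus d) S = 0 :=
    Metric.infDist_zero_of_mem ⟨0, zero_zsmul y⟩
  have := (hconst t).trans (hconst 0).symm
  simpa [hzero] using this

/-- **Kronecker's theorem** in dimension two: the positive multiples of `(a, b)` come close to every
point modulo `1`. -/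
theorem LinearIndependent.exists_nat_mul_near_mod_one {a b : ℝ}
    (h : LinearIndependent ℚ ![(1 : ℝ), a, b]) (s t : ℝ) {ε δ : ℝ} (hε : 0 < ε) (hδ : 0 < δ) :
    ∃ m : ℕ, 1 ≤ m ∧ ∃ p q : ℤ, |m * a - s - p| < ε ∧ |m * b - t - q| < δ := by
  set y : UnitAddTorus (Fin 2) := ![(a : UnitAddCircle), (b : UnitAddCircle)]
  have hy (n : Fin 2 → ℤ) (hn : n ≠ 0) : UnitAddTorus.mFourier n y ≠ 1 := by
    intro h1
    have h2 : AddCircle.toCircle ((n 0 * a + n 1 * b : ℝ) : UnitAddCircle) = 1 := by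
      apply Circle.ext
      simpa [UnitAddTorus.mFourier, y, AddCircle.toCircle_add] using h1
    rw [← AddCircle.toCircle_zero] at h2
    obtain ⟨k, hk⟩ := (AddCircle.coe_eq_zero_iff 1).mp
      (AddCircle.injective_toCircle one_ne_zero h2)
    have h3 := Fintype.linearIndependent_iff.mp h ![-(k : ℚ), n 0, n 1] (by
      simp only [Fin.sum_univ_three, Rat.smul_def]
      simp at hk ⊢
      linarith)
    apply hn
    ext i
    fin_cases i
    · simpa using h3 1
    · simpa using h3 2
  have hdense : Dense ((AddSubmonoid.multiples y : Set (UnitAddTorus (Fin 2)))) := by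
    rw [AddSubmonoid.multiples_eq_closure, dense_addSubmonoidClosure_iff_addSubgroupClosure,
      ← AddSubgroup.zmultiples_eq_closure]
    exact UnitAddTorus.denseRange_zsmul_of_mFourier_ne_one hy
  set z : UnitAddTorus (Fin 2) := ![((s - a : ℝ) : UnitAddCircle), ((t - b : ℝ) : UnitAddCircle)]
  obtain ⟨_, ⟨k, rfl⟩, hw⟩ := hdense.exists_dist_lt z (lt_min hε hδ)
  rw [dist_comm, dist_eq_norm] at hw
  rw [lt_min_iff] at hw
  have h0 : ‖((k * a - (s - a) : ℝ) : UnitAddCircle)‖ < ε := by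
    refine lt_of_le_of_lt (le_of_eq_of_le ?_ (norm_le_pi_norm _ 0)) hw.1
    simp [y, z]
  have h1 : ‖((k * b - (t - b) : ℝ) : UnitAddCircle)‖ < δ := by
    refine lt_of_le_of_lt (le_of_eq_of_le ?_ (norm_le_pi_norm _ 1)) hw.2
    simp [y, z]
  rw [UnitAddCircle.norm_eq] at h0 h1
  refine ⟨k + 1, by omega, round (k * a - (s - a)), round (k * b - (t - b)),
    lt_of_eq_of_lt ?_ h0, lt_of_eq_of_lt ?_ h1⟩ <;>
  · congr 2
    push_cast
    ring

theorem mem_wSet_of_near {d : ℝ} (hd : 0 < d) {m : ℕ} (hm : 1 ≤ m) {p : ℤ}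
    (h : |m * d - (d / 2 - 1 / 2) - p| < d / 2) : m ∈ wSet d := by
  rw [abs_lt] at h
  have hm' : (1 : ℝ) ≤ m := by exact_mod_cast hm
  have hp : 0 < p := by
    have : (0 : ℝ) < p + 1 / 2 := by nlinarith
    have : (-1 : ℝ) < p := by linarith
    have : -1 < p := by exact_mod_cast this
    have : p ≠ 0 := by
      rintro rfl
      simp at h
      nlinarith
    omega
  lift p to ℕ using hp.le
  refine ⟨p, by omega, ?_⟩
  rw [wTerm, eq_comm, Nat.ceil_eq_iff (by omega), lt_div_iff₀ hd, div_le_iff₀ hd]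
  push_cast [hm] at h ⊢
  constructor <;> linarith

theorem notMem_wSet_of_near {d : ℝ} (hd : 0 < d) {m : ℕ} {p : ℤ} (hm : 1 ≤ m)
    (h : |m * d - d / 2 - p| < (1 - d) / 2) : m ∉ wSet d := by
  rintro ⟨n, -, hn⟩
  rw [wTerm, eq_comm, Nat.ceil_eq_iff (by omega), lt_div_iff₀ hd, div_le_iff₀ hd] at hn
  rw [abs_lt] at h
  push_cast [hm] at hn
  have h1 : (n : ℝ) < p + 1 := by linarith
  have h2 : (p : ℝ) < n := by linarith
  have h1' : (n : ℤ) < p + 1 := by exact_mod_cast h1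
  have h2' : p < n := by exact_mod_cast h2
  omega

/-- If `1, α, β` are linearly independent over `ℚ`, then `W_α` and `W_β`
intersect; hence no partition of the positive integers can contain both
as parts. -/
theorem webster_not_disjoint (α β : ℝ)
    (hα0 : 0 < α) (hα1 : α < 1) (hβ0 : 0 < β) (hβ1 : β < 1)
    (hindep : LinearIndependent ℚ ![(1 : ℝ), α, β]) :
    (wSet α ∩ wSet β).Nonempty ∧
    ¬∃ P : Set (Set ℕ),
      wSet α ∈ P ∧ wSet β ∈ P ∧
      P.PairwiseDisjoint id ∧ ⋃₀ P = {n : ℕ | 1 ≤ n} := by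
  have hinter : (wSet α ∩ wSet β).Nonempty := by
    obtain ⟨m, hm, p, q, hp, hq⟩ := hindep.exists_nat_mul_near_mod_one
      (α / 2 - 1 / 2) (β / 2 - 1 / 2) (half_pos hα0) (half_pos hβ0)
    exact ⟨m, mem_wSet_of_near hα0 hm hp, mem_wSet_of_near hβ0 hm hq⟩
  have hne : wSet α ≠ wSet β := by
    obtain ⟨m, hm, p, q, hp, hq⟩ := hindep.exists_nat_mul_near_mod_one
      (α / 2 - 1 / 2) (β / 2) (half_pos hα0) (half_pos (sub_pos.mpr hβ1))
    intro h
    exact notMem_wSet_of_near hβ0 hm hq (h ▸ mem_wSet_of_near hα0 hm hp)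
  refine ⟨hinter, ?_⟩
  rintro ⟨P, hα, hβ, hdisj, -⟩
  exact Set.not_disjoint_iff_nonempty_inter.mpr hinter (hdisj hα hβ hne)
end

section
/- Assume α, β, γ are positive irrational numbers with α + β + γ = 1, β < 1/2 and α < γ; assume additionally that 1, α, β are linearly independent over ℚ, α > 1/3, and γ < 1/2. Then there do not exist strictly increasing sequences (b̃(n)) and (c̃(n)) of positive integers whose ranges, together with W_α, form a partition of ℕ, such that c̃(n) − c(n) ∈ {−1, 0, 1} for all n ∈ ℕ and such that either b̃(n) − b(n) ∈ {−1, 0} for all n ∈ ℕ or b̃(n) − b(n) ∈ {0, 1} for all n ∈ ℕ, where b(n) = ⌈(n − 1/2)/β⌉ and c(n) = ⌈(n − 1/2)/γ⌉. -/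
/-- Simultaneous recurrence: two reals have a common positive multiple close to integers. -/
theorem exists_pos_mul_near_int (a b : ℝ) {ε : ℝ} (hε : 0 < ε) :
    ∃ q : ℕ, 1 ≤ q ∧ ∃ p r : ℤ, |q * a - p| < ε ∧ |q * b - r| < ε := by
  obtain ⟨K, hK⟩ := exists_nat_gt (1 / ε)
  have hK0 : (0 : ℝ) < K := (by positivity : 0 < 1 / ε).trans hK
  have hKε : 1 / (K : ℝ) < ε := by
    rw [div_lt_iff₀ hε] at hK
    rw [div_lt_iff₀ hK0]
    linarith
  have hbox (x : ℝ) : ⌊(K : ℝ) * Int.fract x⌋₊ < K := by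
    rw [Nat.floor_lt (mul_nonneg hK0.le (Int.fract_nonneg x))]
    nlinarith [Int.fract_lt_one x]
  have hclose (x y : ℝ) (h : ⌊(K : ℝ) * Int.fract x⌋₊ = ⌊(K : ℝ) * Int.fract y⌋₊) :
      |y - x - ((⌊y⌋ - ⌊x⌋ : ℤ) : ℝ)| < ε := by
    have hx := Nat.floor_le (mul_nonneg hK0.le (Int.fract_nonneg x))
    have hx' := Nat.lt_floor_add_one ((K : ℝ) * Int.fract x)
    have hy := Nat.floor_le (mul_nonneg hK0.le (Int.fract_nonneg y))
    have hy' := Nat.lt_floor_add_one ((K : ℝ) * Int.fract y)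
    rw [h] at hx hx'
    have hfr : y - x - ((⌊y⌋ - ⌊x⌋ : ℤ) : ℝ) = Int.fract y - Int.fract x := by
      rw [Int.fract, Int.fract]; push_cast; ring
    rw [hfr]
    refine lt_trans ?_ hKε
    rw [abs_lt, ← neg_div, div_lt_iff₀ hK0, lt_div_iff₀ hK0]
    constructor <;> linarith
  obtain ⟨i, j, hij, h⟩ := Finite.exists_ne_map_eq_of_infinite
    (fun i : ℕ ↦ ((⟨_, hbox (i * a)⟩, ⟨_, hbox (i * b)⟩) : Fin K × Fin K))
  wlog hlt : i < j generalizing i j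
  · exact this j i hij.symm h.symm (by omega)
  simp only [Prod.mk.injEq, Fin.mk.injEq] at h
  refine ⟨j - i, by omega, ⌊(j : ℝ) * a⌋ - ⌊(i : ℝ) * a⌋, ⌊(j : ℝ) * b⌋ - ⌊(i : ℝ) * b⌋, ?_, ?_⟩
  · have := hclose _ _ h.1
    rwa [← sub_mul, ← Nat.cast_sub hlt.le] at this
  · have := hclose _ _ h.2
    rwa [← sub_mul, ← Nat.cast_sub hlt.le] at this

/-- Kronecker's theorem in dimension two, with integer multiples. -/
theorem exists_int_mul_near {α β : ℝ} (h : LinearIndependent ℚ ![(1 : ℝ), α, β]) (s t : ℝ)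
    {ε : ℝ} (hε : 0 < ε) :
    ∃ m p r : ℤ, |m * α - p - s| < ε ∧ |m * β - r - t| < ε := by
  have hrel (x y z : ℚ) (hxyz : (x : ℝ) + y * α + z * β = 0) : x = 0 ∧ y = 0 ∧ z = 0 := by
    have := Fintype.linearIndependent_iff.1 h ![x, y, z]
      (by simpa [Fin.sum_univ_three, Rat.smul_def] using hxyz)
    exact ⟨this 0, this 1, this 2⟩
  obtain ⟨q, hq, p, r, hp, hr⟩ := exists_pos_mul_near_int α β (half_pos hε)
  have hq0 : (q : ℚ) ≠ 0 := by positivity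
  set v := (q : ℝ) * α - p with hv
  set w := (q : ℝ) * β - r with hw
  have hv0 : v ≠ 0 := fun h0 ↦
    hq0 (hrel (-p) q 0 (by push_cast; linarith)).2.1
  have hirr : Irrational (w / v) := by
    rintro ⟨c, hc⟩
    rw [eq_div_iff hv0, hv, hw] at hc
    exact hq0 (hrel (c * p - r) (-c * q) q (by push_cast; linarith)).2.2
  have hdense := (dense_addSubgroupClosure_pair_iff (a := w / v) (b := 1)).2 (by simpa using hirr)
  obtain ⟨g, hg, hgt⟩ := hdense.exists_dist_lt (t - s * (w / v)) (half_pos hε)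
  obtain ⟨j, l, rfl⟩ := AddSubgroup.mem_closure_pair.1 hg
  simp only [zsmul_eq_mul, mul_one, Real.dist_eq] at hgt
  set u := (s + j) / v with hu
  have huv : u * v = s + j := div_mul_cancel₀ _ hv0
  have huw : u * w = (s + j) * (w / v) := by rw [hu]; ring
  have hfloor (x : ℝ) (hx : |x| < ε / 2) : |⌊u⌋ * x - u * x| < ε / 2 := by
    rw [← sub_mul, abs_mul, abs_sub_comm]
    have : |u - ⌊u⌋| ≤ 1 := by
      rw [Int.self_sub_floor, abs_of_nonneg (Int.fract_nonneg u)]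
      exact (Int.fract_lt_one u).le
    nlinarith [abs_nonneg x]
  refine ⟨⌊u⌋ * q, ⌊u⌋ * p + j, ⌊u⌋ * r - l, ?_, ?_⟩
  · have := hfloor v hp
    rw [huv] at this
    calc _ = |⌊u⌋ * v - (s + j)| := by rw [hv]; push_cast; congr 1; ring
      _ < ε := by linarith
  · have := hfloor w hr
    rw [huw] at this
    calc _ = |(⌊u⌋ * w - (s + j) * (w / v)) - (t - s * (w / v) - (j * (w / v) + l))| := by
          rw [hw]; push_cast; congr 1; ring
      _ ≤ _ := abs_sub _ _
      _ < ε := by linarith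

/-- Kronecker's theorem in dimension two, with positive multiples. -/
theorem exists_pos_mul_near {α β : ℝ} (h : LinearIndependent ℚ ![(1 : ℝ), α, β]) (s t : ℝ)
    {ε : ℝ} (hε : 0 < ε) :
    ∃ m : ℕ, 1 ≤ m ∧ ∃ p r : ℤ, |m * α - p - s| < ε ∧ |m * β - r - t| < ε := by
  obtain ⟨k, p, r, hp, hr⟩ := exists_int_mul_near h s t (half_pos hε)
  obtain ⟨q, hq, p', r', hp', hr'⟩ := exists_pos_mul_near_int
    ((k.natAbs + 1 : ℕ) * α) ((k.natAbs + 1 : ℕ) * β) (half_pos hε)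
  have hpos : 1 ≤ k + q * (k.natAbs + 1 : ℕ) := by
    have : (1 : ℤ) * (k.natAbs + 1 : ℕ) ≤ q * (k.natAbs + 1 : ℕ) := by gcongr; exact_mod_cast hq
    omega
  obtain ⟨m, hm⟩ := Int.eq_ofNat_of_zero_le (zero_le_one.trans hpos)
  have hmR : (m : ℝ) = k + q * (k.natAbs + 1 : ℕ) := by
    rw [← Int.cast_natCast m, ← hm, Int.cast_add, Int.cast_mul, Int.cast_natCast, Int.cast_natCast]
  refine ⟨m, by omega, p + p', r + r', ?_, ?_⟩
  · calc _ = |(k * α - p - s) + (q * ((k.natAbs + 1 : ℕ) * α) - p')| := by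
          rw [hmR]; push_cast; congr 1; ring
      _ ≤ _ := abs_add_le _ _
      _ < ε := by linarith
  · calc _ = |(k * β - r - t) + (q * ((k.natAbs + 1 : ℕ) * β) - r')| := by
          rw [hmR]; push_cast; congr 1; ring
      _ ≤ _ := abs_add_le _ _
      _ < ε := by linarith

theorem wTerm_le_iff {d : ℝ} (hd : 0 < d) (n m : ℕ) :
    wTerm d n ≤ m ↔ (n : ℝ) ≤ d * m + 1 / 2 := by
  rw [wTerm, Nat.ceil_le, div_le_iff₀ hd]
  constructor <;> intro h <;> linarith

theorem lt_wTerm_iff {d : ℝ} (hd : 0 < d) (n m : ℕ) :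
    m < wTerm d n ↔ d * m + 1 / 2 < n := by
  rw [← not_le, wTerm_le_iff hd, not_le]

theorem strictMonoOn_wTerm {d : ℝ} (hd : 0 < d) (hd1 : d < 1) :
    StrictMonoOn (wTerm d) {n : ℕ | 1 ≤ n} := by
  intro i hi j _ hij
  have hpos : 1 ≤ wTerm d i := by
    have hi' : (1 : ℝ) ≤ i := by exact_mod_cast hi
    rw [Nat.one_le_iff_ne_zero, ← Nat.pos_iff_ne_zero, lt_wTerm_iff hd]
    push_cast
    linarith
  have h : wTerm d i - 1 < wTerm d i := by omega
  rw [lt_wTerm_iff hd, Nat.cast_sub hpos] at h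
  rw [lt_wTerm_iff hd]
  have hij' : (i : ℝ) + 1 ≤ j := by exact_mod_cast hij
  push_cast at h
  linarith

theorem wSet_eq_image (d : ℝ) : wSet d = wTerm d '' {n : ℕ | 1 ≤ n} := by
  ext m
  simp only [wSet, Set.mem_ofPred_eq, Set.mem_image, eq_comm]

/-- If the `k`-th term is at most `m`, the range has at least `k` elements in `[1, m]`. -/
theorem le_ncard_image_inter_Icc {f : ℕ → ℕ} (hf : StrictMonoOn f {n : ℕ | 1 ≤ n})
    (hpos : ∀ n, 1 ≤ n → 1 ≤ f n) {k m : ℕ} (hk : 1 ≤ k) (hm : f k ≤ m) :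
    k ≤ (f '' {n : ℕ | 1 ≤ n} ∩ Set.Icc 1 m).ncard := by
  have hinj : Set.InjOn f (Set.Icc 1 k) := hf.injOn.mono fun _ hx ↦ hx.1
  calc k = (f '' Set.Icc 1 k).ncard := by rw [hinj.ncard_image]; simp
    _ ≤ _ := by
      refine Set.ncard_le_ncard ?_ ((Set.finite_Icc 1 m).inter_of_right _)
      rintro _ ⟨i, hi, rfl⟩
      exact ⟨⟨i, hi.1, rfl⟩, hpos i hi.1, (hf.monotoneOn hi.1 hk hi.2).trans hm⟩

/-- If the `(k + 1)`-st term exceeds `m`, the range has at most `k` elements in `[1, m]`. -/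
theorem ncard_image_inter_Icc_le {f : ℕ → ℕ} (hf : StrictMonoOn f {n : ℕ | 1 ≤ n}) {k m : ℕ}
    (hm : m < f (k + 1)) : (f '' {n : ℕ | 1 ≤ n} ∩ Set.Icc 1 m).ncard ≤ k := by
  calc _ ≤ (f '' Set.Icc 1 k).ncard := by
        refine Set.ncard_le_ncard ?_ ((Set.finite_Icc 1 k).image f)
        rintro _ ⟨⟨i, hi, rfl⟩, hx⟩
        refine ⟨i, ⟨hi, ?_⟩, rfl⟩
        by_contra! hki
        have := hf.monotoneOn (Nat.le_add_left 1 k) hi hki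
        exact absurd hx.2 (by omega)
    _ ≤ (Set.Icc 1 k).ncard := Set.ncard_image_le (Set.finite_Icc 1 k)
    _ = k := by simp

/-- In a partition of the positive integers into three sets, the numbers of elements in `[1, m]`
add up to `m`. -/
theorem ncard_inter_Icc_add_add {A B C : Set ℕ} (hU : A ∪ B ∪ C = {n : ℕ | 1 ≤ n})
    (hAB : Disjoint A B) (hAC : Disjoint A C) (hBC : Disjoint B C) (m : ℕ) :
    (A ∩ Set.Icc 1 m).ncard + (B ∩ Set.Icc 1 m).ncard + (C ∩ Set.Icc 1 m).ncard = m := by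
  have hfin (S : Set ℕ) : (S ∩ Set.Icc 1 m).Finite := (Set.finite_Icc 1 m).inter_of_right S
  rw [← Set.ncard_union_eq (hAB.mono Set.inter_subset_left Set.inter_subset_left)
      (hfin A) (hfin B), ← Set.union_inter_distrib_right,
    ← Set.ncard_union_eq ((hAC.union_left hBC).mono Set.inter_subset_left Set.inter_subset_left)
      (hfin _) (hfin C), ← Set.union_inter_distrib_right, hU,
    Set.inter_eq_right.2 fun x hx ↦ hx.1]
  simp

/-- Optimality of the error bounds: one-sided perturbations of `W_β` are
impossible in a three-part partition with `W_α` exact when `α > 1/3` and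
`γ < 1/2`. -/
theorem one_sided_perturbation_impossible (α β γ : ℝ)
    (hα : 0 < α) (hβ : 0 < β) (hγ : 0 < γ)
    (hαi : Irrational α) (hβi : Irrational β) (hγi : Irrational γ)
    (hsum : α + β + γ = 1) (hβhalf : β < 1/2) (hαγ : α < γ)
    (hindep : LinearIndependent ℚ ![(1 : ℝ), α, β])
    (hα3 : 1/3 < α) (hγ2 : γ < 1/2) :
    ¬∃ bt ct : ℕ → ℕ,
      StrictMonoOn bt {n : ℕ | 1 ≤ n} ∧ StrictMonoOn ct {n : ℕ | 1 ≤ n} ∧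
      wSet α ∪ (bt '' {n : ℕ | 1 ≤ n}) ∪ (ct '' {n : ℕ | 1 ≤ n}) = {n : ℕ | 1 ≤ n} ∧
      Disjoint (wSet α) (bt '' {n : ℕ | 1 ≤ n}) ∧
      Disjoint (wSet α) (ct '' {n : ℕ | 1 ≤ n}) ∧
      Disjoint (bt '' {n : ℕ | 1 ≤ n}) (ct '' {n : ℕ | 1 ≤ n}) ∧
      (∀ n : ℕ, 1 ≤ n →
        ((ct n : ℤ) - (wTerm γ n : ℤ) = -1 ∨ (ct n : ℤ) - (wTerm γ n : ℤ) = 0 ∨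
          (ct n : ℤ) - (wTerm γ n : ℤ) = 1)) ∧
      ((∀ n : ℕ, 1 ≤ n →
          ((bt n : ℤ) - (wTerm β n : ℤ) = -1 ∨ (bt n : ℤ) - (wTerm β n : ℤ) = 0)) ∨
       (∀ n : ℕ, 1 ≤ n →
          ((bt n : ℤ) - (wTerm β n : ℤ) = 0 ∨ (bt n : ℤ) - (wTerm β n : ℤ) = 1))) := by
  rintro ⟨bt, ct, hbt, hct, hU, hAB, hAC, hBC, hc, hb⟩
  have hwt := strictMonoOn_wTerm hα (by linarith)
  rw [wSet_eq_image] at hU hAB hAC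
  have hcount := ncard_inter_Icc_add_add hU hAB hAC hBC
  have hwpos (n : ℕ) (hn : 1 ≤ n) : 1 ≤ wTerm α n :=
    hU.subset (.inl (.inl ⟨n, hn, rfl⟩))
  have hbpos (n : ℕ) (hn : 1 ≤ n) : 1 ≤ bt n := hU.subset (.inl (.inr ⟨n, hn, rfl⟩))
  have hcpos (n : ℕ) (hn : 1 ≤ n) : 1 ≤ ct n := hU.subset (.inr ⟨n, hn, rfl⟩)
  have hγeq : γ = 1 - α - β := by linarith
  obtain ⟨δ, hδ⟩ : ∃ δ, δ = (1 / 2 - γ) / 4 := ⟨_, rfl⟩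
  have hδ0 : 0 < δ := by linarith
  rcases hb with hb | hb
  · obtain ⟨m, hm, a, b, ha, hb'⟩ := exists_pos_mul_near hindep (-1 / 2 + δ) (-1 / 2 + δ) hδ0
    rw [abs_lt] at ha hb'
    have hmR : (1 : ℝ) ≤ m := by exact_mod_cast hm
    have hαm : 0 < α * m := by positivity
    have hβm : 0 < β * m := by positivity
    have hγm : 0 < γ * m := by positivity
    have hγm' : γ * m = m - α * m - β * m := by rw [hγeq]; ring
    have ha0 : 0 < a := by
      have : (0 : ℝ) < a := by linarith
      exact_mod_cast this
    have hb0 : 0 < b := by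
      have : (0 : ℝ) < b := by linarith
      exact_mod_cast this
    have hc0 : 0 < m - a - b + 1 := by
      have : (0 : ℝ) < m - a - b + 1 := by linarith
      exact_mod_cast this
    lift a to ℕ using ha0.le
    lift b to ℕ using hb0.le
    obtain ⟨c, hc'⟩ := Int.eq_ofNat_of_zero_le hc0.le
    have hcR : (m : ℝ) - a - b + 1 = c := by exact_mod_cast hc'
    push_cast at ha hb'
    have hA := le_ncard_image_inter_Icc hwt hwpos (k := a) (m := m) (by omega)
      ((wTerm_le_iff hα a m).2 (by linarith))
    have hB := le_ncard_image_inter_Icc hbt hbpos (k := b) (m := m) (by omega) (by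
      have := (wTerm_le_iff hβ b m).2 (by linarith)
      have := hb b (by omega)
      omega)
    have hC := le_ncard_image_inter_Icc hct hcpos (k := c) (m := m) (by omega) (by
      have := (wTerm_le_iff hγ c (m - 1)).2 (by rw [Nat.cast_sub hm]; push_cast; linarith)
      have := hc c (by omega)
      omega)
    have := hcount m
    omega
  · obtain ⟨m, hm, a, b, ha, hb'⟩ := exists_pos_mul_near hindep (1 / 2 - δ) (1 / 2 - δ) hδ0
    rw [abs_lt] at ha hb'
    have hmR : (1 : ℝ) ≤ m := by exact_mod_cast hm
    have hαm : 0 < α * m := by positivity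
    have hβm : 0 < β * m := by positivity
    have hγm : 0 < γ * m := by positivity
    have hγm' : γ * m = m - α * m - β * m := by rw [hγeq]; ring
    have ha0 : -1 < a := by
      have : (-1 : ℝ) < a := by linarith
      exact_mod_cast this
    have hb0 : -1 < b := by
      have : (-1 : ℝ) < b := by linarith
      exact_mod_cast this
    have hc0 : -1 < m - a - b - 1 := by
      have : (-1 : ℝ) < m - a - b - 1 := by linarith
      exact_mod_cast this
    lift a to ℕ using (by omega)
    lift b to ℕ using (by omega)
    obtain ⟨c, hc'⟩ := Int.eq_ofNat_of_zero_le (a := m - a - b - 1) (by omega)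
    have hcR : (m : ℝ) - a - b - 1 = c := by exact_mod_cast hc'
    push_cast at ha hb'
    have hA := ncard_image_inter_Icc_le hwt (k := a) (m := m)
      ((lt_wTerm_iff hα (a + 1) m).2 (by push_cast; linarith))
    have hB := ncard_image_inter_Icc_le hbt (k := b) (m := m) (by
      have := (lt_wTerm_iff hβ (b + 1) m).2 (by push_cast; linarith)
      have := hb (b + 1) (by omega)
      omega)
    have hC := ncard_image_inter_Icc_le hct (k := c) (m := m) (by
      have := (lt_wTerm_iff hγ (c + 1) (m + 1)).2 (by push_cast; linarith)
      have := hc (c + 1) (by omega)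
      omega)
    have := hcount m
    omega
end
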